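/- The third homotopy group π₃(S², N) of the 2-sphere is isomorphic, as a group, to the integers ℤ. -/

import Mathlib

open scoped unitInterval Topology Topology.Homotopy

namespace Pi3

section general
variable {N : Type} {X X' : Type*} [TopologicalSpace X] [TopologicalSpace X']

/-- The class of a generalized loop in the homotopy group. -/
def cl {x : X} (f : GenLoop N X x) : HomotopyGroup N X x := Quotient.mk _ f

lemma cl_surj {x : X} (a : HomotopyGroup N X x) : ∃ f, cl f = a := Quotient.exists_rep a

lemma cl_eq_iff {x : X} {f g : GenLoop N X x} : cl f = cl g ↔ GenLoop.Homotopic f g :=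
  Quotient.eq

/-- Two loops are identified as soon as a homotopy, fixed on the boundary, is given. -/
lemma cl_eq_of_homotopy {x : X} {f g : GenLoop N X x} (H : C(I × (N → I), X))
    (h0 : ∀ s, H (0, s) = f s) (h1 : ∀ s, H (1, s) = g s)
    (hb : ∀ t, ∀ s ∈ Cube.boundary N, H (t, s) = x) : cl f = cl g := by
  rw [cl_eq_iff]
  exact ⟨⟨⟨H, h0, h1⟩, fun t s hs => by
    change H (t, s) = f s
    rw [hb t s hs]; exact (f.2 s hs).symm⟩⟩

/-- Push a generalized loop forward along a continuous map. -/
def mapGL (φ : C(X, X')) {x : X} {x' : X'} (hx : φ x = x') (f : GenLoop N X x) :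
    GenLoop N X' x' :=
  ⟨φ.comp f.1, fun y hy => by
    have := f.2 y hy
    simp only [ContinuousMap.comp_apply]
    rw [this, hx]⟩

@[simp] lemma mapGL_apply (φ : C(X, X')) {x : X} {x' : X'} (hx : φ x = x') (f : GenLoop N X x)
    (t : N → I) : mapGL φ hx f t = φ (f t) := rfl

lemma mapGL_homotopic (φ : C(X, X')) {x : X} {x' : X'} (hx : φ x = x') {f g : GenLoop N X x}
    (h : GenLoop.Homotopic f g) : GenLoop.Homotopic (mapGL φ hx f) (mapGL φ hx g) :=
  ContinuousMap.HomotopicRel.comp_continuousMap h φ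

variable [DecidableEq N]

lemma transAt_apply {x : X} (i : N) (f g : GenLoop N X x) (t : N → I) :
    GenLoop.transAt i f g t = if (t i : ℝ) ≤ 1 / 2
      then f (Function.update t i <| Set.projIcc 0 1 zero_le_one (2 * (t i : ℝ)))
      else g (Function.update t i <| Set.projIcc 0 1 zero_le_one (2 * (t i : ℝ) - 1)) := rfl

lemma symmAt_apply {x : X} (i : N) (f : GenLoop N X x) (t : N → I) :
    GenLoop.symmAt i f t = f fun j ↦ if j = i then σ (t i) else t j := rfl

lemma transAt_mapGL (φ : C(X, X')) {x : X} {x' : X'} (hx : φ x = x') (i : N)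
    (f g : GenLoop N X x) :
    mapGL φ hx (GenLoop.transAt i f g) = GenLoop.transAt i (mapGL φ hx f) (mapGL φ hx g) := by
  ext t
  simp only [mapGL_apply, transAt_apply]
  split_ifs <;> rfl

variable [Nonempty N]

lemma mul_cl {x : X} (i : N) (p q : GenLoop N X x) :
    cl p * cl q = cl (GenLoop.transAt i q p) :=
  HomotopyGroup.mul_spec

lemma inv_cl {x : X} (i : N) (p : GenLoop N X x) :
    (cl p)⁻¹ = cl (GenLoop.symmAt i p) :=
  HomotopyGroup.inv_spec

lemma one_cl {x : X} : (1 : HomotopyGroup N X x) = cl GenLoop.const := rfl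

/-- The induced homomorphism on homotopy groups. -/
noncomputable def piMap (φ : C(X, X')) {x : X} {x' : X'} (hx : φ x = x') :
    HomotopyGroup N X x →* HomotopyGroup N X' x' :=
  MonoidHom.mk' (Quotient.map (mapGL φ hx) (fun _ _ h => mapGL_homotopic φ hx h)) (by
    rintro ⟨a⟩ ⟨b⟩
    obtain ⟨i⟩ := (inferInstance : Nonempty N)
    change Quotient.map _ _ (cl a * cl b) = cl (mapGL φ hx a) * cl (mapGL φ hx b)
    rw [mul_cl i, mul_cl i, ← transAt_mapGL]
    rfl)

lemma piMap_cl (φ : C(X, X')) {x : X} {x' : X'} (hx : φ x = x') (f : GenLoop N X x) :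
    piMap φ hx (cl f) = cl (mapGL φ hx f) := rfl

/-- Homeomorphisms induce isomorphisms on homotopy groups. -/
noncomputable def piEquiv (e : X ≃ₜ X') {x : X} {x' : X'} (hx : e x = x') :
    HomotopyGroup N X x ≃* HomotopyGroup N X' x' :=
  MulEquiv.ofBijective (piMap (N := N) (e : C(X, X')) hx) (by
    have hx' : (e.symm : C(X', X)) x' = x := by simp [← hx]
    refine Function.bijective_iff_has_inverse.2 ⟨piMap (N := N) (e.symm : C(X', X)) hx', ?_, ?_⟩
    · intro a
      obtain ⟨a, rfl⟩ := cl_surj a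
      rw [piMap_cl, piMap_cl]
      congr 1; ext t; simp
    · intro a
      obtain ⟨a, rfl⟩ := cl_surj a
      rw [piMap_cl, piMap_cl]
      congr 1; ext t; simp)

end general
end Pi3

open scoped unitInterval Topology Topology.Homotopy

namespace Pi3

/-- The unit sphere in three-space. -/
abbrev S2 := Metric.sphere (0 : EuclideanSpace ℝ (Fin 3)) 1

/-- The punctured complex plane `ℂ² ∖ 0`. -/
abbrev Yc := {z : ℂ × ℂ // z ≠ 0}

/-- The squared hermitian norm. -/
def nsq (z : ℂ × ℂ) : ℝ := z.1.re ^ 2 + z.1.im ^ 2 + (z.2.re ^ 2 + z.2.im ^ 2)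

lemma nsq_pos {z : ℂ × ℂ} (hz : z ≠ 0) : 0 < nsq z := by
  unfold nsq
  by_contra h
  apply hz
  have h1 : z.1.re = 0 := by nlinarith [sq_nonneg z.1.re, sq_nonneg z.1.im, sq_nonneg z.2.re, sq_nonneg z.2.im]
  have h2 : z.1.im = 0 := by nlinarith [sq_nonneg z.1.re, sq_nonneg z.1.im, sq_nonneg z.2.re, sq_nonneg z.2.im]
  have h3 : z.2.re = 0 := by nlinarith [sq_nonneg z.1.re, sq_nonneg z.1.im, sq_nonneg z.2.re, sq_nonneg z.2.im]
  have h4 : z.2.im = 0 := by nlinarith [sq_nonneg z.1.re, sq_nonneg z.1.im, sq_nonneg z.2.re, sq_nonneg z.2.im]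
  exact Prod.ext (Complex.ext h1 h2) (Complex.ext h3 h4)

lemma nsq_zero : nsq 0 = 0 := by simp [nsq]

@[fun_prop] lemma continuous_nsq : Continuous nsq := by
  unfold nsq; fun_prop

/-- Unnormalised Hopf coordinates. -/
def hA (z : ℂ × ℂ) : ℝ := 2 * (z.1.re * z.2.re + z.1.im * z.2.im)
/-- Unnormalised Hopf coordinates. -/
def hB (z : ℂ × ℂ) : ℝ := 2 * (z.1.im * z.2.re - z.1.re * z.2.im)
/-- Unnormalised Hopf coordinates. -/
def hC (z : ℂ × ℂ) : ℝ := z.1.re ^ 2 + z.1.im ^ 2 - (z.2.re ^ 2 + z.2.im ^ 2)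

lemma hABC (z : ℂ × ℂ) : hA z ^ 2 + hB z ^ 2 + hC z ^ 2 = nsq z ^ 2 := by
  unfold hA hB hC nsq; ring

@[fun_prop] lemma continuous_hA : Continuous hA := by unfold hA; fun_prop
@[fun_prop] lemma continuous_hB : Continuous hB := by unfold hB; fun_prop
@[fun_prop] lemma continuous_hC : Continuous hC := by unfold hC; fun_prop

lemma S2_eq (p : S2) : p.1 0 ^ 2 + p.1 1 ^ 2 + p.1 2 ^ 2 = 1 := by
  have h := p.2
  rw [mem_sphere_zero_iff_norm, EuclideanSpace.norm_eq] at h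
  rw [Real.sqrt_eq_one] at h
  simpa [Fin.sum_univ_three] using h

/-- The Hopf map `ℂ² ∖ 0 → S²`. -/
noncomputable def hopf : C(Yc, S2) where
  toFun z := ⟨!₂[hA z.1 / nsq z.1, hB z.1 / nsq z.1, hC z.1 / nsq z.1], by
    rw [mem_sphere_zero_iff_norm, EuclideanSpace.norm_eq, Real.sqrt_eq_one]
    have h := nsq_pos z.2
    simp only [Fin.sum_univ_three, Real.norm_eq_abs, sq_abs]
    simp only [Matrix.cons_val_zero, Matrix.cons_val_one, Matrix.cons_val, div_pow]
    rw [← add_div, ← add_div, hABC, div_self (by positivity)]⟩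
  continuous_toFun := by
    have h : ∀ z : Yc, nsq z.1 ≠ 0 := fun z => (nsq_pos z.2).ne'
    refine Continuous.subtype_mk ?_ _
    refine (PiLp.continuous_toLp 2 _).comp ?_
    refine continuous_pi fun i => ?_
    fin_cases i
    · exact Continuous.div (by fun_prop) (by fun_prop) h
    · exact Continuous.div (by fun_prop) (by fun_prop) h
    · exact Continuous.div (by fun_prop) (by fun_prop) h

lemma hopf_0 (z : Yc) : (hopf z).1 0 = hA z.1 / nsq z.1 := rfl
lemma hopf_1 (z : Yc) : (hopf z).1 1 = hB z.1 / nsq z.1 := rfl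
lemma hopf_2 (z : Yc) : (hopf z).1 2 = hC z.1 / nsq z.1 := rfl

lemma S2_ext {p q : S2} (h0 : p.1 0 = q.1 0) (h1 : p.1 1 = q.1 1) (h2 : p.1 2 = q.1 2) :
    p = q := by
  apply Subtype.ext
  ext i
  fin_cases i
  · exact h0
  · exact h1
  · exact h2

/-- Orthogonal projection of `z` to the complex line with coordinate `p`. -/
noncomputable def prj (p : S2) (z : ℂ × ℂ) : ℂ × ℂ :=
  (((1 + (p.1 2 : ℂ)) * z.1 + ((p.1 0 : ℂ) + (p.1 1 : ℂ) * Complex.I) * z.2) / 2,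
   (((p.1 0 : ℂ) - (p.1 1 : ℂ) * Complex.I) * z.1 + (1 - (p.1 2 : ℂ)) * z.2) / 2)

lemma continuous_prj : Continuous fun q : S2 × (ℂ × ℂ) => prj q.1 q.2 := by
  unfold prj
  have h : ∀ i : Fin 3, Continuous fun q : S2 × (ℂ × ℂ) => ((q.1.1 i : ℝ) : ℂ) := by
    intro i
    exact Complex.continuous_ofReal.comp
      ((EuclideanSpace.proj (𝕜 := ℝ) i).continuous.comp (continuous_subtype_val.comp continuous_fst))
  have h0 := h 0
  have h1 := h 1
  have h2 := h 2
  fun_prop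

lemma prj_re1 (p : S2) (z : ℂ × ℂ) : (prj p z).1.re =
    ((1 + p.1 2) * z.1.re + (p.1 0 * z.2.re - p.1 1 * z.2.im)) / 2 := by
  simp [prj]
lemma prj_im1 (p : S2) (z : ℂ × ℂ) : (prj p z).1.im =
    ((1 + p.1 2) * z.1.im + (p.1 0 * z.2.im + p.1 1 * z.2.re)) / 2 := by
  simp [prj]
lemma prj_re2 (p : S2) (z : ℂ × ℂ) : (prj p z).2.re =
    ((p.1 0 * z.1.re + p.1 1 * z.1.im) + (1 - p.1 2) * z.2.re) / 2 := by
  simp [prj]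
lemma prj_im2 (p : S2) (z : ℂ × ℂ) : (prj p z).2.im =
    ((p.1 0 * z.1.im - p.1 1 * z.1.re) + (1 - p.1 2) * z.2.im) / 2 := by
  simp [prj]; ring

lemma nsq_prj (p : S2) (z : ℂ × ℂ) :
    2 * nsq (prj p z) = nsq z + p.1 0 * hA z + p.1 1 * hB z + p.1 2 * hC z := by
  have h := S2_eq p
  unfold nsq hA hB hC
  rw [prj_re1, prj_im1, prj_re2, prj_im2]
  linear_combination ((z.1.re ^ 2 + z.1.im ^ 2 + (z.2.re ^ 2 + z.2.im ^ 2)) / 2) * h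

lemma hA_prj (p : S2) (z : ℂ × ℂ) : hA (prj p z) = p.1 0 * nsq (prj p z) := by
  have h := S2_eq p
  unfold nsq hA
  rw [prj_re1, prj_im1, prj_re2, prj_im2]
  generalize p.1 0 = a at *
  generalize p.1 1 = b at *
  generalize p.1 2 = c at *
  linear_combination (-(z.1.re*z.2.re + z.1.im*z.2.im)/2 - a * (z.1.re ^ 2 + z.1.im ^ 2 + (z.2.re ^ 2 + z.2.im ^ 2)) / 4) * h

lemma hB_prj (p : S2) (z : ℂ × ℂ) : hB (prj p z) = p.1 1 * nsq (prj p z) := by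
  have h := S2_eq p
  unfold nsq hB
  rw [prj_re1, prj_im1, prj_re2, prj_im2]
  generalize p.1 0 = a at *
  generalize p.1 1 = b at *
  generalize p.1 2 = c at *
  linear_combination (-(z.1.im*z.2.re - z.1.re*z.2.im)/2 - b * (z.1.re ^ 2 + z.1.im ^ 2 + (z.2.re ^ 2 + z.2.im ^ 2)) / 4) * h

lemma hC_prj (p : S2) (z : ℂ × ℂ) : hC (prj p z) = p.1 2 * nsq (prj p z) := by
  have h := S2_eq p
  unfold nsq hC
  rw [prj_re1, prj_im1, prj_re2, prj_im2]
  generalize p.1 0 = a at *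
  generalize p.1 1 = b at *
  generalize p.1 2 = c at *
  linear_combination (-(z.1.re ^ 2 + z.1.im ^ 2 - (z.2.re ^ 2 + z.2.im ^ 2))/4 - c * (z.1.re ^ 2 + z.1.im ^ 2 + (z.2.re ^ 2 + z.2.im ^ 2)) / 4) * h

lemma hopf_prj (p : S2) (z : ℂ × ℂ) (h : prj p z ≠ 0) : hopf ⟨prj p z, h⟩ = p := by
  have h' := (nsq_pos h).ne'
  apply S2_ext
  · rw [hopf_0, hA_prj, mul_div_cancel_right₀ _ h']
  · rw [hopf_1, hB_prj, mul_div_cancel_right₀ _ h']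
  · rw [hopf_2, hC_prj, mul_div_cancel_right₀ _ h']

lemma prj_ne_zero (p : S2) (z : Yc) (h : dist p (hopf z) < 2) : prj p z.1 ≠ 0 := by
  intro h0
  have h1 := nsq_prj p z.1
  rw [h0, nsq_zero] at h1
  have hn := nsq_pos z.2
  have e0 : hA z.1 = (hopf z).1 0 * nsq z.1 := by rw [hopf_0]; field_simp
  have e1 : hB z.1 = (hopf z).1 1 * nsq z.1 := by rw [hopf_1]; field_simp
  have e2 : hC z.1 = (hopf z).1 2 * nsq z.1 := by rw [hopf_2]; field_simp
  rw [e0, e1, e2] at h1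
  have h2 : 1 + p.1 0 * (hopf z).1 0 + p.1 1 * (hopf z).1 1 + p.1 2 * (hopf z).1 2 = 0 := by
    have : nsq z.1 * (1 + p.1 0 * (hopf z).1 0 + p.1 1 * (hopf z).1 1 + p.1 2 * (hopf z).1 2) = 0 := by
      linarith
    exact (mul_eq_zero.1 this).resolve_left hn.ne'
  have h3 := S2_eq p
  have h4 := S2_eq (hopf z)
  have h5 : dist p (hopf z) ^ 2 = 4 := by
    rw [Subtype.dist_eq, EuclideanSpace.dist_eq, Real.sq_sqrt (by positivity)]
    simp only [Fin.sum_univ_three, Real.dist_eq, sq_abs]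
    nlinarith
  nlinarith [dist_nonneg (x := p) (y := hopf z)]

/-- The coefficient of `v` along `y`. -/
noncomputable def coef (y v : ℂ × ℂ) : ℂ :=
  (v.1 * (starRingEnd ℂ) y.1 + v.2 * (starRingEnd ℂ) y.2) / (nsq y : ℂ)

lemma prj_hopf (y : Yc) (v : ℂ × ℂ) : prj (hopf y) v = coef y.1 v • y.1 := by
  have hn := nsq_pos y.2
  have hn' : (nsq y.1 : ℂ) ≠ 0 := by exact_mod_cast hn.ne'
  obtain ⟨⟨⟨a, b⟩, ⟨c, d⟩⟩, hy⟩ := y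
  obtain ⟨⟨x1, x2⟩, ⟨x3, x4⟩⟩ := v
  have E : ∀ r : ℝ, ∀ w : ℂ, w / (r : ℂ) = ⟨w.re / r, w.im / r⟩ := by
    intro r w; apply Complex.ext <;> simp
  unfold coef
  rw [E]
  apply Prod.ext <;> apply Complex.ext
  · rw [prj_re1]; simp only [hopf_0, hopf_1, hopf_2]
    simp [hA, hB, hC] at *
    field_simp
    simp only [nsq]; ring
  · rw [prj_im1]; simp only [hopf_0, hopf_1, hopf_2]
    simp [hA, hB, hC] at *
    field_simp
    simp only [nsq]; ring
  · rw [prj_re2]; simp only [hopf_0, hopf_1, hopf_2]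
    simp [hA, hB, hC] at *
    field_simp
    simp only [nsq]; ring
  · rw [prj_im2]; simp only [hopf_0, hopf_1, hopf_2]
    simp [hA, hB, hC] at *
    field_simp
    simp only [nsq]; ring

lemma coef_self (y : Yc) : coef y.1 y.1 = 1 := by
  have hn := nsq_pos y.2
  have hn' : (nsq y.1 : ℂ) ≠ 0 := by exact_mod_cast hn.ne'
  unfold coef
  rw [div_eq_one_iff_eq hn', Complex.mul_conj, Complex.mul_conj, ← Complex.ofReal_add]
  congr 1
  simp [nsq, Complex.normSq_apply]; ring

lemma prj_self (y : Yc) : prj (hopf y) y.1 = y.1 := by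
  rw [prj_hopf, coef_self, one_smul]

lemma fiber_eq {y v : Yc} (h : hopf v = hopf y) : v.1 = coef y.1 v.1 • y.1 := by
  rw [← prj_hopf, ← h, prj_self]

lemma hopf_smul (c : ℂ) (v : Yc) (h : c • v.1 ≠ 0) : hopf ⟨c • v.1, h⟩ = hopf v := by
  have hn := nsq_pos v.2
  have hc : c ≠ 0 := by rintro rfl; simp at h
  have hc' : c.re ^ 2 + c.im ^ 2 ≠ 0 := by
    have := Complex.normSq_pos.2 hc
    rw [Complex.normSq_apply] at this
    nlinarith
  have e : nsq (c • v.1) = (c.re ^ 2 + c.im ^ 2) * nsq v.1 := by simp [nsq]; ring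
  apply S2_ext
  · rw [hopf_0, hopf_0]; dsimp only; rw [e, ← mul_div_mul_left (hA v.1) _ hc']; congr 1; simp [hA]; ring
  · rw [hopf_1, hopf_1]; dsimp only; rw [e, ← mul_div_mul_left (hB v.1) _ hc']; congr 1; simp [hB]; ring
  · rw [hopf_2, hopf_2]; dsimp only; rw [e, ← mul_div_mul_left (hC v.1) _ hc']; congr 1; simp [hC]; ring

lemma hopf_surj (p : S2) : ∃ y, hopf y = p := by
  by_cases h : prj p (1, 0) = 0
  · have h' : prj p (0, 1) ≠ 0 := by
      intro h'
      have a := congrArg (fun z => z.1.re) h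
      have b := congrArg (fun z => z.2.re) h'
      simp only [prj_re1, prj_re2] at a b
      simp at a b
      linarith
    exact ⟨_, hopf_prj p _ h'⟩
  · exact ⟨_, hopf_prj p _ h⟩

end Pi3

open scoped unitInterval Topology Topology.Homotopy

namespace Pi3

/-- Truncation of time at `r`. -/
noncomputable def cut (r : ℝ) (t : I) : I := Set.projIcc 0 1 zero_le_one (min (t : ℝ) r)

lemma continuous_cut (r : ℝ) : Continuous (cut r) := by
  unfold cut
  exact continuous_projIcc.comp (by fun_prop)

lemma cut_val {r : ℝ} (hr : 0 ≤ r) (t : I) : (cut r t : ℝ) = min (t : ℝ) r := by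
  unfold cut
  rw [Set.projIcc_of_mem zero_le_one ⟨le_min t.2.1 hr, (min_le_left _ _).trans t.2.2⟩]

lemma continuous_prj_comp {B : Type*} [TopologicalSpace B] {a : B → S2} {b : B → ℂ × ℂ}
    (ha : Continuous a) (hb : Continuous b) : Continuous fun q => prj (a q) (b q) := by
  unfold prj
  have h : ∀ i : Fin 3, Continuous fun q => (((a q).1 i : ℝ) : ℂ) := by
    intro i
    exact Complex.continuous_ofReal.comp
      ((EuclideanSpace.proj (𝕜 := ℝ) i).continuous.comp (continuous_subtype_val.comp ha))
  have h0 := h 0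
  have h1 := h 1
  have h2 := h 2
  fun_prop

/-- Homotopy lifting for the Hopf map, with constant lifts of constant paths. -/
lemma hlp {A : Type*} [PseudoMetricSpace A] [CompactSpace A] (f : C(I × A, S2)) (g : C(A, Yc))
    (h0 : ∀ a, hopf (g a) = f (0, a)) :
    ∃ G : C(I × A, Yc), (∀ t a, hopf (G (t, a)) = f (t, a)) ∧ (∀ a, G (0, a) = g a) ∧
      ∀ a, (∀ t, f (t, a) = f (0, a)) → ∀ t, G (t, a) = g a := by
  have huc := CompactSpace.uniformContinuous_of_continuous f.continuous
  obtain ⟨δ, hδ, hd⟩ := Metric.uniformContinuous_iff.1 huc 2 (by norm_num)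
  obtain ⟨n, hn⟩ := exists_nat_one_div_lt hδ
  set ε : ℝ := 1 / ((n : ℝ) + 1) with hε
  have hεpos : 0 < ε := by positivity
  have key : ∀ k : ℕ, ∃ G : C(I × A, Yc), (∀ t a, hopf (G (t, a)) = f (cut (k * ε) t, a)) ∧
      (∀ a, G (0, a) = g a) ∧ ∀ a, (∀ t, f (t, a) = f (0, a)) → ∀ t, G (t, a) = g a := by
    intro k
    induction k with
    | zero =>
      refine ⟨g.comp ⟨Prod.snd, continuous_snd⟩, ?_, fun _ => rfl, fun _ _ _ => rfl⟩
      intro t a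
      have : cut ((0 : ℕ) * ε) t = 0 := by
        apply Subtype.ext
        rw [cut_val (by simp)]
        simpa using t.2.1
      rw [this]
      exact h0 a
    | succ k ih =>
      obtain ⟨G, h1, h2, h3⟩ := ih
      have hne : ∀ q : I × A, prj (f (cut ((k + 1 : ℕ) * ε) q.1, q.2)) (G q).1 ≠ 0 := by
        rintro ⟨t, a⟩
        apply prj_ne_zero
        rw [h1]
        apply hd
        rw [Prod.dist_eq, dist_self, max_lt_iff]
        refine ⟨?_, hδ⟩
        rw [Subtype.dist_eq, cut_val (by positivity), cut_val (by positivity), Real.dist_eq]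
        refine lt_of_le_of_lt ?_ hn
        refine (abs_min_sub_min_le_max _ _ _ _).trans ?_
        push_cast
        rw [sub_self, abs_zero, add_mul, one_mul, add_sub_cancel_left, abs_of_pos hεpos]
        exact max_le hεpos.le le_rfl
      have c1 : Continuous fun q : I × A => f (cut ((k + 1 : ℕ) * ε) q.1, q.2) :=
        f.continuous.comp (((continuous_cut _).comp continuous_fst).prodMk continuous_snd)
      have c2 : Continuous fun q : I × A => (G q).1 :=
        continuous_subtype_val.comp G.continuous
      have c3 : Continuous fun q : I × A => prj (f (cut ((k + 1 : ℕ) * ε) q.1, q.2)) (G q).1 :=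
        continuous_prj_comp c1 c2
      let G1 : C(I × A, Yc) :=
        ⟨fun q => ⟨prj (f (cut ((k + 1 : ℕ) * ε) q.1, q.2)) (G q).1, hne q⟩, c3.subtype_mk _⟩
      refine ⟨G1, ?_, ?_, ?_⟩
      · intro t a
        exact hopf_prj _ _ (hne (t, a))
      · intro a
        apply Subtype.ext
        change prj (f (cut _ 0, a)) (G (0, a)).1 = (g a).1
        have : cut ((k + 1 : ℕ) * ε) 0 = 0 := by
          apply Subtype.ext
          rw [cut_val (by positivity)]
          simp; positivity
        rw [this, h2, ← h0, prj_self]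
      · intro a ha t
        apply Subtype.ext
        change prj (f (cut _ t, a)) (G (t, a)).1 = (g a).1
        rw [h3 a ha, ha, ← h0, prj_self]
  obtain ⟨G, h1, h2, h3⟩ := key (n + 1)
  refine ⟨G, ?_, h2, h3⟩
  intro t a
  rw [h1]
  congr 2
  apply Subtype.ext
  rw [cut_val (by positivity)]
  push_cast
  rw [hε, mul_one_div_cancel (by positivity)]
  exact min_eq_left t.2.2

lemma log_const_of_path (u : I → ℂ) (hu : Continuous u) (h : ∀ t, Complex.exp (u t) = 1) :
    u 0 = u 1 := by
  have h1 : ∀ t, ∃ n : ℤ, u t = n * (2 * Real.pi * Complex.I) := fun t => Complex.exp_eq_one_iff.1 (h t)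
  choose n hn using h1
  have hp : (2 * Real.pi) ≠ 0 := by positivity
  have hc : Continuous fun t => ((n t : ℤ) : ℝ) := by
    have : (fun t => ((n t : ℤ) : ℝ)) = fun t => (u t).im / (2 * Real.pi) := by
      funext t
      rw [hn t]
      simp
    rw [this]
    fun_prop
  have hc' : Continuous n := by
    rw [Int.isClosedEmbedding_coe_real.isInducing.continuous_iff]
    exact hc
  have := PreconnectedSpace.constant (inferInstance : PreconnectedSpace I) hc' (x := 0) (y := 1)
  rw [hn, hn, this]

lemma log_lift {N : Type} [Fintype N] [DecidableEq N] [Nontrivial N] (μ : C(N → I, ℂ)) (hne : ∀ s, μ s ≠ 0)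
    (hb : ∀ s ∈ Cube.boundary N, μ s = 1) :
    ∃ θ : C(N → I, ℂ), (∀ s, Complex.exp (θ s) = μ s) ∧ ∀ s ∈ Cube.boundary N, θ s = 0 := by
  let pr : C(N → ℝ, N → I) := ⟨fun x i => Set.projIcc 0 1 zero_le_one (x i),
    continuous_pi fun i => continuous_projIcc.comp (continuous_apply i)⟩
  let M : C(N → ℝ, {z : ℂ // z ≠ 0}) := ⟨fun x => ⟨μ (pr x), hne _⟩,
    (μ.continuous.comp pr.continuous).subtype_mk _⟩
  obtain ⟨j0⟩ := (inferInstance : Nonempty N)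
  have hpr0 : pr 0 = 0 := by
    funext i
    apply Subtype.ext
    change ((Set.projIcc 0 1 zero_le_one (0:ℝ) : I) : ℝ) = 0
    rw [Set.projIcc_left]
  obtain ⟨F, ⟨hF0, hF⟩, -⟩ := Complex.isCoveringMap_exp.existsUnique_continuousMap_lifts M 0 0 (by
    apply Subtype.ext
    change Complex.exp 0 = μ (pr 0)
    rw [Complex.exp_zero, hpr0, hb]
    exact ⟨j0, Or.inl rfl⟩)
  let ι : C(N → I, N → ℝ) := ⟨fun s i => s i, by fun_prop⟩
  have hpi : ∀ s, pr (ι s) = s := by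
    intro s; funext i
    exact Set.projIcc_val zero_le_one (s i)
  let θ := F.comp ι
  have hθ : ∀ s, Complex.exp (θ s) = μ s := by
    intro s
    have := congrArg Subtype.val (congrFun hF (ι s))
    change Complex.exp (F (ι s)) = μ (pr (ι s)) at this
    rw [hpi] at this
    exact this
  refine ⟨θ, hθ, ?_⟩
  have hθ0 : θ 0 = 0 := by
    change F (ι 0) = 0
    rw [← hF0]; congr 1
  -- contract along the boundary
  have step : ∀ (γ : I → N → I), Continuous γ → (∀ t, γ t ∈ Cube.boundary N) →
      θ (γ 0) = θ (γ 1) := by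
    intro γ hγ hγb
    exact log_const_of_path (fun t => θ (γ t)) (θ.continuous.comp hγ)
      (fun t => by rw [hθ, hb _ (hγb t)])
  intro s ⟨i, hi⟩
  obtain ⟨j, hj⟩ := exists_ne i
  have h1 := step (fun t k => if k = i then s i else t * s k) (by
    refine continuous_pi fun k => ?_
    split_ifs <;> fun_prop) (fun t => ⟨i, by simpa using hi⟩)
  have h2 := step (fun t k => if k = i then t * s i else 0) (by
    refine continuous_pi fun k => ?_
    split_ifs <;> fun_prop) (fun t => ⟨j, by simp [hj]⟩)
  have e1 : (fun k => if k = i then s i else 1 * s k) = s := by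
    funext k; split_ifs with h <;> simp [h]
  have e2 : (fun k => if k = i then s i else 0 * s k) = (fun k => if k = i then 1 * s i else 0) := by
    funext k; split_ifs with h <;> simp
  have e3 : (fun k => if k = i then 0 * s i else (0 : I)) = 0 := by
    funext k; split_ifs with h <;> simp
  rw [e1, e2] at h1
  rw [e3] at h2
  rw [← h1, ← h2, hθ0]

/-- Given a partial homotopy ending in a fibre and constant on the boundary, rotate it so that it
ends at the base point. -/
lemma rotate {N : Type} [Fintype N] [DecidableEq N] [Nontrivial N] (y : Yc)
    (G : C(I × (N → I), Yc)) (h1 : ∀ s, hopf (G (1, s)) = hopf y)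
    (hb : ∀ t, ∀ s ∈ Cube.boundary N, G (t, s) = y) :
    ∃ G' : C(I × (N → I), Yc), (∀ q, hopf (G' q) = hopf (G q)) ∧ (∀ s, G' (0, s) = G (0, s)) ∧
      (∀ s, G' (1, s) = y) ∧ ∀ t, ∀ s ∈ Cube.boundary N, G' (t, s) = y := by
  let μ : C(N → I, ℂ) := ⟨fun s => coef y.1 (G (1, s)).1, by
    unfold coef
    have : Continuous fun s : N → I => (G (1, s)).1 :=
      continuous_subtype_val.comp (G.continuous.comp (by fun_prop))
    fun_prop⟩
  have hμ : ∀ s, (G (1, s)).1 = μ s • y.1 := fun s => fiber_eq (h1 s)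
  obtain ⟨θ, hθ, hθb⟩ := log_lift μ (fun s hs => (G (1, s)).2 (by rw [hμ, hs, zero_smul]))
    (fun s hs => by
      change coef y.1 (G (1, s)).1 = 1
      rw [hb 1 s hs, coef_self])
  have hne : ∀ q : I × (N → I), Complex.exp (-((q.1 : ℝ) : ℂ) * θ q.2) • (G q).1 ≠ 0 := fun q =>
    smul_ne_zero (Complex.exp_ne_zero _) (G q).2
  have c2 : Continuous fun q : I × (N → I) => (G q).1 :=
    continuous_subtype_val.comp G.continuous
  have c1 : Continuous fun q : I × (N → I) => Complex.exp (-((q.1 : ℝ) : ℂ) * θ q.2) := by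
    fun_prop
  have c3 : Continuous fun q : I × (N → I) =>
      Complex.exp (-((q.1 : ℝ) : ℂ) * θ q.2) • (G q).1 := c1.smul c2
  let G1 : C(I × (N → I), Yc) :=
    ⟨fun q => ⟨Complex.exp (-((q.1 : ℝ) : ℂ) * θ q.2) • (G q).1, hne q⟩, c3.subtype_mk _⟩
  refine ⟨G1, ?_, ?_, ?_, ?_⟩
  · intro q
    exact hopf_smul _ _ _
  · intro s
    apply Subtype.ext
    change Complex.exp (-(((0 : I) : ℝ) : ℂ) * θ s) • (G (0, s)).1 = (G (0, s)).1
    simp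
  · intro s
    apply Subtype.ext
    change Complex.exp (-(((1 : I) : ℝ) : ℂ) * θ s) • (G (1, s)).1 = y.1
    rw [hμ, ← hθ, smul_smul, ← Complex.exp_add]
    simp
  · intro t s hs
    apply Subtype.ext
    change Complex.exp (-((t : ℝ) : ℂ) * θ s) • (G (t, s)).1 = y.1
    rw [hθb s hs, hb t s hs]
    simp

lemma hopf_inj (y : Yc) :
    Function.Injective (piMap (N := Fin 3) hopf (rfl : hopf y = hopf y)) := by
  rw [injective_iff_map_eq_one]
  intro a ha
  obtain ⟨g, rfl⟩ := cl_surj a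
  rw [piMap_cl, one_cl, cl_eq_iff] at ha
  obtain ⟨H⟩ := ha
  obtain ⟨G, h1, h2, h3⟩ := hlp H.toContinuousMap g.1 (fun s => (H.apply_zero s).symm)
  have hb : ∀ t, ∀ s ∈ Cube.boundary (Fin 3), G (t, s) = y := by
    intro t s hs
    rw [h3 s (fun t => (H.eq_fst t hs).trans (H.eq_fst 0 hs).symm)]
    exact g.2 s hs
  obtain ⟨G', -, k2, k3, k4⟩ := rotate y G (fun s => (h1 1 s).trans (H.apply_one s)) hb
  rw [one_cl]
  exact cl_eq_of_homotopy G' (fun s => by rw [k2, h2]; rfl) (fun s => k3 s) k4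

lemma hopf_surjective (y : Yc) :
    Function.Surjective (piMap (N := Fin 3) hopf (rfl : hopf y = hopf y)) := by
  intro a
  obtain ⟨f, rfl⟩ := cl_surj a
  have : Nontrivial {j : Fin 3 // j ≠ 0} := ⟨⟨1, by decide⟩, ⟨2, by decide⟩, by decide⟩
  obtain ⟨G, h1, h2, h3⟩ := hlp (f.1.comp ⟨Cube.insertAt (0 : Fin 3), (Cube.insertAt (0 : Fin 3)).continuous⟩)
    (ContinuousMap.const _ y) (fun s => by
      refine (f.2 _ ?_).symm
      exact Cube.insertAt_boundary (0 : Fin 3) (Or.inl (Or.inl rfl)))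
  have hb : ∀ t, ∀ s ∈ Cube.boundary {j : Fin 3 // j ≠ 0}, G (t, s) = y := by
    intro t s hs
    refine h3 s (fun t => ?_) t
    have e : ∀ t, f.1 (Cube.insertAt (0 : Fin 3) (t, s)) = hopf y := fun t =>
      f.2 _ (Cube.insertAt_boundary (0 : Fin 3) (Or.inr hs))
    exact (e t).trans (e 0).symm
  obtain ⟨G', k1, k2, k3, k4⟩ := rotate y G (fun s => (h1 1 s).trans (by
      refine f.2 _ ?_
      exact Cube.insertAt_boundary (0 : Fin 3) (Or.inl (Or.inr rfl)))) hb
  refine ⟨cl ⟨G'.comp ⟨Cube.splitAt (0 : Fin 3), (Cube.splitAt (0 : Fin 3)).continuous⟩, ?_⟩, ?_⟩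
  · rintro s ⟨i, hi⟩
    change G' (s 0, fun j => s j) = y
    by_cases h : i = 0
    · subst h
      rcases hi with hi | hi
      · rw [hi, k2, h2]; rfl
      · rw [hi, k3]
    · exact k4 _ _ ⟨⟨i, h⟩, hi⟩
  · rw [piMap_cl]
    congr 1
    ext1 s
    change hopf (G' (Cube.splitAt (0 : Fin 3) s)) = f s
    rw [k1]
    refine (h1 _ _).trans ?_
    change f.1 (Cube.insertAt (0 : Fin 3) (Cube.splitAt (0 : Fin 3) s)) = f s
    rw [Homeomorph.symm_apply_apply]
    rfl

/-- The Hopf map induces an isomorphism on `π₃`. -/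
noncomputable def hopfEquiv (y : Yc) :
    HomotopyGroup (Fin 3) Yc y ≃* HomotopyGroup (Fin 3) S2 (hopf y) :=
  MulEquiv.ofBijective _ ⟨hopf_inj y, hopf_surjective y⟩

end Pi3

open scoped unitInterval Topology Topology.Homotopy

namespace Pi3

/-- Three-space with the sup norm. -/
abbrev V := Fin 3 → ℝ

/-- Four-space. -/
abbrev E4 := ℝ × V

/-- Punctured four-space. -/
abbrev Y4 := {v : E4 // v ≠ 0}

/-- The unit cube. -/
abbrev Q := Fin 3 → I

/-- The base vector. -/
def b0 : E4 := (1, 0)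

lemma b0_ne : b0 ≠ 0 := by
  intro h
  have := congrArg Prod.fst h
  simp [b0] at this

/-- The base point. -/
def y0 : Y4 := ⟨b0, b0_ne⟩

/-- The cut-off scale of the collapse map. -/
noncomputable def sc (l : ℝ) (v : E4) : ℝ := max 0 (-v.1 - l * ‖v.2‖)

/-- The collapse map. -/
noncomputable def K (l : ℝ) (v : E4) : E4 := (1 - 2 * sc l v / ‖v‖, sc l v • v.2)

lemma sc_nonneg (l : ℝ) (v : E4) : 0 ≤ sc l v := le_max_left _ _

lemma K_cont {B : Type*} [TopologicalSpace B] {l : B → ℝ} {v : B → E4} (hl : Continuous l)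
    (hv : Continuous v) (hne : ∀ b, v b ≠ 0) : Continuous fun b => K (l b) (v b) := by
  have h1 : Continuous fun b => sc (l b) (v b) := by
    unfold sc
    fun_prop
  unfold K
  refine Continuous.prodMk ?_ ?_
  · exact continuous_const.sub ((continuous_const.mul h1).div hv.norm
      (fun b => norm_ne_zero_iff.2 (hne b)))
  · exact h1.smul (continuous_snd.comp hv)

lemma K_eq_b0 {l : ℝ} {v : E4} (h : -v.1 ≤ l * ‖v.2‖) : K l v = b0 := by
  have : sc l v = 0 := max_eq_left (by linarith)
  simp [K, this, b0]

lemma K_line {l : ℝ} {v : E4} (hv : v ≠ 0) (t : ℝ) (h0 : 0 ≤ t) (h1 : t ≤ 1) :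
    (1 - t) • v + t • K l v ≠ 0 := by
  intro h
  have e1 := congrArg Prod.fst h
  have e2 := congrArg Prod.snd h
  simp only [Prod.fst_add, Prod.smul_fst, Prod.snd_add, Prod.smul_snd, smul_eq_mul, K,
    Prod.fst_zero, Prod.snd_zero] at e1 e2
  by_cases hv2 : v.2 = 0
  · have hv1 : v.1 ≠ 0 := fun h => hv (Prod.ext h hv2)
    have hn : ‖v‖ = |v.1| := by
      rw [Prod.norm_def, hv2, norm_zero, Real.norm_eq_abs]
      exact max_eq_left (abs_nonneg _)
    have hs : sc l v = max 0 (-v.1) := by simp [sc, hv2]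
    rw [hn, hs] at e1
    rcases lt_or_gt_of_ne hv1 with h | h
    · rw [max_eq_right (by linarith), abs_of_neg h, mul_div_assoc, div_self (by linarith)] at e1
      have h5 : 0 ≤ (1 - t) * (-v.1) := mul_nonneg (by linarith) (by linarith)
      have h6 : t = 0 := by linarith
      rw [h6] at e1
      linarith
    · rw [max_eq_left (by linarith)] at e1
      simp only [mul_zero, zero_div, sub_zero, mul_one] at e1
      have h5 : 0 ≤ (1 - t) * v.1 := mul_nonneg (by linarith) (by linarith)
      have h6 : t = 0 := by linarith
      rw [h6] at e1
      linarith
  · rw [smul_smul, ← add_smul, smul_eq_zero, or_iff_left hv2] at e2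
    have := sc_nonneg l v
    have h3 : 0 ≤ t * sc l v := mul_nonneg h0 this
    have h4 : t = 1 := by linarith
    subst h4
    have h5 : sc l v = 0 := by linarith
    rw [h5] at e1
    simp at e1

lemma K_ne {l : ℝ} {v : E4} (hv : v ≠ 0) : K l v ≠ 0 := by
  have := K_line (l := l) hv 1 zero_le_one le_rfl
  simpa using this

/-- Compactness: away from the negative axis the collapse map is eventually constant. -/
lemma K_eventually {B : Type*} [TopologicalSpace B] {S : Set B} (hS : IsCompact S) {w : B → E4}
    (hw : Continuous w) (hne : ∀ b, w b ≠ 0) (hg : ∀ b ∈ S, (w b).1 < 0 → (w b).2 ≠ 0) :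
    ∃ l0 : ℝ, ∀ l ≥ l0, ∀ b ∈ S, K l (w b) = b0 := by
  have hU : ∀ n : ℕ, IsOpen {b | -(w b).1 < n * ‖(w b).2‖} := fun n =>
    isOpen_lt (by fun_prop) (by fun_prop)
  obtain ⟨n, hn⟩ := hS.elim_directed_cover (fun n : ℕ => {b | -(w b).1 < n * ‖(w b).2‖}) hU (by
    intro b hb
    rw [Set.mem_iUnion]
    by_cases h : (w b).2 = 0
    · refine ⟨0, ?_⟩
      have h1 : ¬ (w b).1 < 0 := fun h' => hg b hb h' h
      have h2 : (w b).1 ≠ 0 := fun h' => hne b (Prod.ext h' h)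
      have : 0 < (w b).1 := lt_of_le_of_ne (not_lt.1 h1) (Ne.symm h2)
      simpa using this
    · have hp : 0 < ‖(w b).2‖ := norm_pos_iff.2 h
      obtain ⟨n, hn⟩ := exists_nat_gt (-(w b).1 / ‖(w b).2‖)
      exact ⟨n, (div_lt_iff₀ hp).1 hn⟩) (by
    apply directed_of_isDirected_le
    intro m n hmn b hb
    simp only [Set.mem_ofPred_eq] at hb ⊢
    refine lt_of_lt_of_le hb ?_
    gcongr)
  refine ⟨n, fun l hl b hb => K_eq_b0 ?_⟩
  have h1 : -(w b).1 < n * ‖(w b).2‖ := hn hb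
  have h2 : (n : ℝ) * ‖(w b).2‖ ≤ l * ‖(w b).2‖ := by gcongr
  linarith

lemma isCompact_boundary : IsCompact (Cube.boundary (Fin 3)) := by
  apply IsClosed.isCompact
  have : Cube.boundary (Fin 3) = ⋃ i : Fin 3, {s : Q | s i = 0 ∨ s i = 1} := by
    ext s; simp [Cube.boundary]
  rw [this]
  refine isClosed_iUnion_of_finite fun i => ?_
  exact (isClosed_eq (continuous_apply i) continuous_const).union
    (isClosed_eq (continuous_apply i) continuous_const)

/-- The third homotopy group under study. -/
abbrev P3 := HomotopyGroup (Fin 3) Y4 y0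

/-- The collapsed loop of `w`. -/
noncomputable def KL (l : ℝ) (w : Q → E4) (hw : Continuous w) (hne : ∀ s, w s ≠ 0)
    (hb : ∀ s ∈ Cube.boundary (Fin 3), K l (w s) = b0) : GenLoop (Fin 3) Y4 y0 :=
  ⟨⟨fun s => ⟨K l (w s), K_ne (hne s)⟩, (K_cont continuous_const hw hne).subtype_mk _⟩,
    fun s hs => Subtype.ext (hb s hs)⟩

/-- The collapsed map of `w` eventually represents elements of `H`. -/
def Rep (H : Subgroup P3) (w : Q → E4) : Prop :=
  ∃ l0 : ℝ, ∀ l ≥ l0, ∃ g : GenLoop (Fin 3) Y4 y0, (∀ s, (g s).1 = K l (w s)) ∧ cl g ∈ H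

lemma Rep.homotopy {H : Subgroup P3} (w : I × Q → E4) (hw : Continuous w) (hne : ∀ q, w q ≠ 0)
    (hg : ∀ t, ∀ s ∈ Cube.boundary (Fin 3), (w (t, s)).1 < 0 → (w (t, s)).2 ≠ 0)
    (h : Rep H fun s => w (1, s)) : Rep H fun s => w (0, s) := by
  obtain ⟨l1, h1⟩ := h
  obtain ⟨l2, h2⟩ := K_eventually (isCompact_univ.prod isCompact_boundary) hw hne
    (fun b hb => hg b.1 b.2 hb.2)
  refine ⟨max l1 l2, fun l hl => ?_⟩
  have h2' : ∀ t, ∀ s ∈ Cube.boundary (Fin 3), K l (w (t, s)) = b0 := fun t s hs =>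
    h2 l (le_of_max_le_right hl) (t, s) ⟨Set.mem_univ _, hs⟩
  obtain ⟨g, hg1, hg2⟩ := h1 l (le_of_max_le_left hl)
  refine ⟨KL l (fun s => w (0, s)) (by fun_prop) (fun s => hne _) (h2' 0), fun s => rfl, ?_⟩
  have e : cl (KL l (fun s => w (0, s)) (by fun_prop) (fun s => hne _) (h2' 0)) = cl g := by
    let G : C(I × Q, Y4) := ⟨fun q => ⟨K l (w q), K_ne (hne q)⟩,
      (K_cont continuous_const hw hne).subtype_mk _⟩
    refine cl_eq_of_homotopy G (fun s => rfl) (fun s => ?_) (fun t s hs => ?_)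
    · exact Subtype.ext (hg1 s).symm
    · exact Subtype.ext (h2' t s hs)
  rw [e]
  exact hg2

/-- Straight line version. -/
lemma Rep.line {H : Subgroup P3} {w0 w1 : Q → E4} (hw0 : Continuous w0) (hw1 : Continuous w1)
    (hne : ∀ t : ℝ, 0 ≤ t → t ≤ 1 → ∀ s, (1 - t) • w0 s + t • w1 s ≠ 0)
    (hg : ∀ t : ℝ, 0 ≤ t → t ≤ 1 → ∀ s ∈ Cube.boundary (Fin 3),
      (1 - t) • (w0 s).2 + t • (w1 s).2 ≠ 0)
    (h : Rep H w1) : Rep H w0 := by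
  have := Rep.homotopy (H := H) (fun q => (1 - (q.1 : ℝ)) • w0 q.2 + (q.1 : ℝ) • w1 q.2)
    (by fun_prop) (fun q => hne _ q.1.2.1 q.1.2.2 _) (fun t s hs _ => hg _ t.2.1 t.2.2 s hs)
    (by simpa using h)
  simpa using this

/-- The parametrised box. -/
def pb (a b : V) (s : Q) : V := fun i => a i + s i * (b i - a i)

@[fun_prop] lemma pb_cont (a b : V) : Continuous (pb a b) := by
  unfold pb; fun_prop

/-- Cutting in two along a coordinate. -/
lemma Rep.cut {H : Subgroup P3} {W : V → E4} {a b : V} (i : Fin 3)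
    (h1 : Rep H fun s => W (pb a (Function.update b i ((a i + b i) / 2)) s))
    (h2 : Rep H fun s => W (pb (Function.update a i ((a i + b i) / 2)) b s)) :
    Rep H fun s => W (pb a b s) := by
  obtain ⟨l1, h1⟩ := h1
  obtain ⟨l2, h2⟩ := h2
  refine ⟨max l1 l2, fun l hl => ?_⟩
  obtain ⟨g1, hg1, hm1⟩ := h1 l (le_of_max_le_left hl)
  obtain ⟨g2, hg2, hm2⟩ := h2 l (le_of_max_le_right hl)
  refine ⟨GenLoop.transAt i g1 g2, fun s => ?_, ?_⟩
  · rw [transAt_apply]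
    split_ifs with hs
    · rw [hg1]
      refine congrArg (fun x => K l (W x)) ?_
      funext j
      simp only [pb]
      by_cases hj : j = i
      · subst hj
        rw [Function.update_self, Function.update_self, Set.projIcc_of_mem zero_le_one
          ⟨by have := (s j).2.1; positivity, by linarith⟩]
        simp only
        ring
      · rw [Function.update_of_ne hj, Function.update_of_ne hj]
    · rw [hg2]
      refine congrArg (fun x => K l (W x)) ?_
      funext j
      simp only [pb]
      by_cases hj : j = i
      · subst hj
        rw [Function.update_self, Function.update_self, Set.projIcc_of_mem zero_le_one
          ⟨by linarith, by have := (s j).2.2; linarith⟩]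
        simp only
        ring
      · rw [Function.update_of_ne hj, Function.update_of_ne hj]
  · rw [← mul_cl]
    exact mul_mem hm2 hm1

/-- Reflecting one coordinate. -/
lemma Rep.flip {H : Subgroup P3} {w : Q → E4} (i : Fin 3) (h : Rep H w) :
    Rep H fun s => w (fun j => if j = i then σ (s i) else s j) := by
  obtain ⟨l1, h1⟩ := h
  refine ⟨l1, fun l hl => ?_⟩
  obtain ⟨g1, hg1, hm1⟩ := h1 l hl
  refine ⟨GenLoop.symmAt i g1, fun s => ?_, ?_⟩
  · rw [symmAt_apply, hg1]
  · rw [← inv_cl]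
    exact inv_mem hm1

/-- Maps avoiding the negative axis. -/
lemma Rep.trivial {H : Subgroup P3} {w : Q → E4} (hw : Continuous w) (hne : ∀ s, w s ≠ 0)
    (hg : ∀ s, (w s).1 < 0 → (w s).2 ≠ 0) : Rep H w := by
  obtain ⟨l2, h2⟩ := K_eventually isCompact_univ hw hne (fun b _ => hg b)
  refine ⟨l2, fun l hl => ⟨GenLoop.const, fun s => ?_, ?_⟩⟩
  · rw [h2 l hl s (Set.mem_univ _)]; rfl
  · rw [← one_cl]
    exact one_mem H

end Pi3

open scoped unitInterval Topology Topology.Homotopy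

namespace Pi3

/-- The linear piece. -/
noncomputable def wL (A : Matrix (Fin 3) (Fin 3) ℝ) (s : Q) : E4 :=
  (-1, A.mulVec fun i => (s i : ℝ) - 1 / 2)

lemma wL_ne (A : Matrix (Fin 3) (Fin 3) ℝ) (s : Q) : wL A s ≠ 0 := by
  intro h
  have := congrArg Prod.fst h
  simp [wL] at this

lemma center_ne {s : Q} (hs : s ∈ Cube.boundary (Fin 3)) :
    (fun i => (s i : ℝ) - 1 / 2) ≠ 0 := by
  obtain ⟨i, hi⟩ := hs
  intro h
  have := congrFun h i
  rcases hi with hi | hi <;> rw [hi] at this <;> norm_num at this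

lemma mulVec_ne {A : Matrix (Fin 3) (Fin 3) ℝ} (hA : A.det ≠ 0) {v : V} (hv : v ≠ 0) :
    A.mulVec v ≠ 0 := fun h => hv (Matrix.eq_zero_of_mulVec_eq_zero hA h)

/-- Joined to a sign matrix inside the invertible matrices. -/
def SJ (A : Matrix (Fin 3) (Fin 3) ℝ) : Prop :=
  ∃ (M : I → Matrix (Fin 3) (Fin 3) ℝ) (e : Fin 3 → ℝ), Continuous M ∧ (∀ t, (M t).det ≠ 0) ∧
    M 0 = A ∧ M 1 = Matrix.diagonal e ∧ ∀ i, e i = 1 ∨ e i = -1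

lemma SJ.all {A : Matrix (Fin 3) (Fin 3) ℝ} (hA : A.det ≠ 0) : SJ A := by
  refine Matrix.diagonal_transvection_induction_of_det_ne_zero SJ A hA ?_ ?_ ?_
  · intro D hD
    have hD' : ∀ i, D i ≠ 0 := by
      rw [Matrix.det_diagonal] at hD
      exact fun i => (Finset.prod_ne_zero_iff.1 hD) i (Finset.mem_univ i)
    refine ⟨fun t => Matrix.diagonal fun i => (1 - (t : ℝ)) * D i + t * SignType.sign (D i),
      fun i => SignType.sign (D i), ?_, ?_, ?_, ?_, ?_⟩
    · exact Continuous.matrix_diagonal (by fun_prop)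
    · intro t
      rw [Matrix.det_diagonal, Finset.prod_ne_zero_iff]
      intro i _
      have h0 := t.2.1
      have h1 := t.2.2
      rcases lt_or_gt_of_ne (hD' i) with h | h
      · rw [sign_neg h]
        simp only [SignType.coe_neg_one]
        intro h'
        have h5 : 0 ≤ (1 - (t : ℝ)) * (-D i) := mul_nonneg (by linarith) (by linarith)
        have h6 : (t : ℝ) = 0 := by linarith
        rw [h6] at h'
        linarith
      · rw [sign_pos h]
        simp only [SignType.coe_one]
        intro h'
        have h5 : 0 ≤ (1 - (t : ℝ)) * (D i) := mul_nonneg (by linarith) (by linarith)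
        have h6 : (t : ℝ) = 0 := by linarith
        rw [h6] at h'
        linarith
    · simp
    · simp
    · intro i
      rcases lt_or_gt_of_ne (hD' i) with h | h
      · right; simp [sign_neg h]
      · left; simp [sign_pos h]
  · intro T
    refine ⟨fun t => Matrix.transvection T.i T.j ((1 - (t : ℝ)) * T.c), fun _ => 1, ?_, ?_, ?_, ?_,
      fun _ => Or.inl rfl⟩
    · unfold Matrix.transvection
      refine continuous_const.add ?_
      refine continuous_matrix fun i j => ?_
      simp only [Matrix.single_apply]
      split_ifs <;> fun_prop
    · intro t
      rw [Matrix.det_transvection_of_ne _ _ T.hij]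
      exact one_ne_zero
    · simp [Matrix.TransvectionStruct.toMatrix]
    · simp [Matrix.transvection]
  · rintro A B hA hB ⟨M, e, h1, h2, h3, h4, h5⟩ ⟨M', e', h1', h2', h3', h4', h5'⟩
    refine ⟨fun t => M t * M' t, fun i => e i * e' i, h1.mul h1', ?_, ?_, ?_, ?_⟩
    · intro t
      rw [Matrix.det_mul]
      exact mul_ne_zero (h2 t) (h2' t)
    · simp only [h3, h3']
    · simp only [h4, h4', Matrix.diagonal_mul_diagonal]
    · intro i
      rcases h5 i with h | h <;> rcases h5' i with h' | h' <;> simp [h, h']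

lemma wI_bd (l : ℝ) (hl : 2 ≤ l) (s : Q) (hs : s ∈ Cube.boundary (Fin 3)) :
    K l (wL 1 s) = b0 := by
  apply K_eq_b0
  obtain ⟨i, hi⟩ := hs
  have h1 : ‖(fun i => (s i : ℝ) - 1 / 2) i‖ ≤ ‖fun i => (s i : ℝ) - 1 / 2‖ := norm_le_pi_norm (fun i => (s i : ℝ) - 1 / 2) i
  have h2 : ‖(s i : ℝ) - 1 / 2‖ = 1 / 2 := by
    rcases hi with hi | hi <;> rw [hi] <;> norm_num
  simp only [h2] at h1
  simp only [wL, Matrix.one_mulVec]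
  nlinarith

lemma wL_cont (A : Matrix (Fin 3) (Fin 3) ℝ) : Continuous (wL A) := by
  unfold wL
  refine continuous_const.prodMk (Continuous.matrix_mulVec continuous_const (by fun_prop))

/-- The generator. -/
noncomputable def gen : P3 := cl (KL 2 (wL 1) (wL_cont 1) (wL_ne 1) (wI_bd 2 le_rfl))

/-- The cyclic subgroup. -/
noncomputable abbrev HZ : Subgroup P3 := Subgroup.zpowers gen

lemma rep_one : Rep HZ (wL 1) := by
  refine ⟨2, fun l hl => ⟨KL l (wL 1) (wL_cont 1) (wL_ne 1) (wI_bd l hl), fun s => rfl, ?_⟩⟩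
  have : cl (KL l (wL 1) (wL_cont 1) (wL_ne 1) (wI_bd l hl)) = gen := by
    have hc : Continuous fun q : I × Q => K (l + q.1 * (2 - l)) (wL 1 q.2) :=
      K_cont (by fun_prop) ((wL_cont 1).comp continuous_snd) (fun q => wL_ne _ _)
    let G : C(I × Q, Y4) := ⟨fun q => ⟨K (l + q.1 * (2 - l)) (wL 1 q.2), K_ne (wL_ne _ _)⟩,
      hc.subtype_mk _⟩
    refine cl_eq_of_homotopy G (fun s => ?_) (fun s => ?_) (fun t s hs => ?_)
    · apply Subtype.ext
      change K (l + ((0 : I) : ℝ) * (2 - l)) (wL 1 s) = K l (wL 1 s)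
      simp
    · apply Subtype.ext
      change K (l + ((1 : I) : ℝ) * (2 - l)) (wL 1 s) = K 2 (wL 1 s)
      simp
    · refine Subtype.ext (wI_bd _ ?_ s hs)
      have := t.2.1
      have := t.2.2
      nlinarith
  rw [this]
  exact Subgroup.mem_zpowers _

lemma rep_flip {e : Fin 3 → ℝ} (h : Rep HZ (wL (Matrix.diagonal e))) (i : Fin 3) :
    Rep HZ (wL (Matrix.diagonal (Function.update e i (-e i)))) := by
  have := h.flip i
  convert this using 2 with s
  unfold wL
  refine Prod.ext rfl ?_
  funext j
  simp only [Matrix.mulVec_diagonal]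
  by_cases hj : j = i
  · subst hj
    simp
    ring
  · simp [hj]

lemma rep_sign (e : Fin 3 → ℝ) (he : ∀ i, e i = 1 ∨ e i = -1) :
    Rep HZ (wL (Matrix.diagonal e)) := by
  have hup : ∀ (i : Fin 3) (e : Fin 3 → ℝ) , (e i = 1 ∨ e i = -1) →
      Rep HZ (wL (Matrix.diagonal (Function.update e i 1))) → Rep HZ (wL (Matrix.diagonal e)) := by
    intro i e he h
    rcases he with h' | h'
    · rwa [← h', Function.update_eq_self] at h
    · have := rep_flip h i
      rwa [Function.update_self, Function.update_idem, ← h', Function.update_eq_self] at this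
  refine hup 0 e (he 0) (hup 1 _ ?_ (hup 2 _ ?_ ?_))
  · simpa using he 1
  · simpa using he 2
  · have : Function.update (Function.update (Function.update e 0 1) 1 1) 2 1
      = (fun _ => (1 : ℝ)) := by
      funext j; fin_cases j <;> simp [Function.update]
    rw [this, Matrix.diagonal_one]
    exact rep_one

lemma rep_linear (A : Matrix (Fin 3) (Fin 3) ℝ) (hA : A.det ≠ 0) : Rep HZ (wL A) := by
  obtain ⟨M, e, h1, h2, h3, h4, h5⟩ := SJ.all hA
  have := Rep.homotopy (H := HZ) (fun q => wL (M q.1) q.2) (by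
    unfold wL
    refine continuous_const.prodMk (Continuous.matrix_mulVec (h1.comp continuous_fst) ?_)
    fun_prop) (fun q => wL_ne _ _) (fun t s hs _ => mulVec_ne (h2 t) (center_ne hs))
    (by
      change Rep HZ (wL (M 1))
      rw [h4]
      exact rep_sign e h5)
  change Rep HZ (wL (M 0)) at this
  rwa [h3] at this

end Pi3

open scoped unitInterval Topology Topology.Homotopy

namespace Pi3

lemma pb_mem {a b : V} (hab : ∀ i, a i < b i) (s : Q) : pb a b s ∈ Set.Icc a b := by
  constructor <;> intro i
  · have h := (s i).2.1
    have := mul_nonneg h (sub_nonneg.2 (hab i).le)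
    simp only [pb]; linarith
  · have h := (s i).2.2
    have := mul_le_mul_of_nonneg_right h (sub_nonneg.2 (hab i).le)
    simp only [pb]; linarith

lemma pb_bd {a b : V} (hab : ∀ i, a i < b i) {s : Q} (hs : s ∈ Cube.boundary (Fin 3)) {z : V}
    (hz : ∀ i, a i < z i ∧ z i < b i) : pb a b s ≠ z := by
  obtain ⟨i, hi⟩ := hs
  rintro rfl
  have := hz i
  simp only [pb] at this
  rcases hi with hi | hi <;> rw [hi] at this <;> simp at this

/-- Linear pieces with arbitrary center. -/
lemma rep_affine (A : V →L[ℝ] V) (hA : LinearMap.det (A : V →ₗ[ℝ] V) ≠ 0) {a b z : V}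
    (hab : ∀ i, a i < b i) (hz : ∀ i, a i < z i ∧ z i < b i) :
    Rep HZ (fun s => ((-1 : ℝ), A (pb a b s - z))) := by
  have hinj : ∀ v : V, A v = 0 → v = 0 := by
    intro v hv
    have h1 := (LinearMap.equivOfDetNeZero (A : V →ₗ[ℝ] V) hA).injective
    apply h1
    rw [map_zero]
    exact hv
  set c : V := fun i => (a i + b i) / 2 with hc
  have hc' : ∀ i, a i < c i ∧ c i < b i := fun i => by
    have := hab i
    constructor <;> simp only [hc] <;> linarith
  have h1 : Rep HZ (fun s => ((-1 : ℝ), A (pb a b s - c))) := by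
    have := rep_linear (LinearMap.toMatrix' (A : V →ₗ[ℝ] V) * Matrix.diagonal (b - a)) (by
      rw [Matrix.det_mul, LinearMap.det_toMatrix', Matrix.det_diagonal]
      refine mul_ne_zero hA (Finset.prod_ne_zero_iff.2 fun i _ => ?_)
      have := hab i
      simp only [Pi.sub_apply]
      linarith)
    convert this using 2 with s
    unfold wL
    rw [← Matrix.mulVec_mulVec, LinearMap.toMatrix'_mulVec]
    refine Prod.ext rfl ?_
    change A _ = A _
    congr 1
    funext i
    rw [Matrix.mulVec_diagonal]
    simp only [pb, hc, Pi.sub_apply]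
    ring
  refine Rep.line (by fun_prop) (by fun_prop) ?_ ?_ h1
  · intro t _ _ s h
    have := congrArg Prod.fst h
    simp at this
    linarith
  · intro t ht0 ht1 s hs h
    simp only [← map_smul, ← map_add] at h
    have h2 := hinj _ h
    refine pb_bd hab hs (z := (1 - t) • z + t • c) ?_ ?_
    · intro i
      have h3 := hz i
      have h4 := hc' i
      exact convex_Ioo (a i) (b i) h3 h4 (sub_nonneg.2 ht1) ht0 (by ring)
    · rw [← sub_eq_zero, ← h2]
      module

/-- The local statement at a transverse zero. -/
lemma rep_local_zero {W : V → E4} (hW : Continuous W) {z : V} (hz1 : (W z).1 < 0)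
    (hz2 : (W z).2 = 0) {A : V →L[ℝ] V} (hd : HasFDerivAt (fun x => (W x).2) A z)
    (hA : LinearMap.det (A : V →ₗ[ℝ] V) ≠ 0) :
    ∃ U ∈ 𝓝 z, ∀ a b : V, (∀ i, a i < b i) → Set.Icc a b ⊆ U → (∀ i, a i < z i ∧ z i < b i) →
      Rep HZ (fun s => W (pb a b s)) := by
  obtain ⟨k, hk0, hk⟩ := LinearMap.exists_antilipschitzWith (A : V →ₗ[ℝ] V)
    (by
      rw [LinearMap.ker_eq_bot]
      exact (LinearMap.equivOfDetNeZero (A : V →ₗ[ℝ] V) hA).injective)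
  have hk' : ∀ v, ‖v‖ ≤ k * ‖A v‖ := fun v => by
    have := hk.le_mul_dist v 0
    simpa using this
  have hkp : (0 : ℝ) < k := hk0
  have h1 : ∀ᶠ y in 𝓝 z, (W y).1 < 0 :=
    (continuous_fst.comp hW).continuousAt.eventually_lt continuousAt_const hz1
  have h2 := hd.isLittleO.def (c := 1 / (2 * k)) (by positivity)
  refine ⟨_, h1.and h2, fun a b hab hU hz => ?_⟩
  refine Rep.line (by fun_prop) ?_ ?_ ?_ (rep_affine A hA hab hz)
  · fun_prop
  · intro t ht0 ht1 s h
    have h3 := (hU (pb_mem hab s)).1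
    have := congrArg Prod.fst h
    simp at this
    have h5 : 0 ≤ (1 - t) * (-(W (pb a b s)).1) := mul_nonneg (by linarith) (by linarith)
    have h6 : t = 0 := by linarith
    rw [h6] at this
    linarith
  · intro t ht0 ht1 s hs h
    have h3 := (hU (pb_mem hab s)).2
    have hne := pb_bd hab hs hz
    set y := pb a b s
    rw [hz2, sub_zero] at h3
    have hp : 0 < ‖y - z‖ := norm_pos_iff.2 (sub_ne_zero.2 hne)
    have h4 := hk' (y - z)
    have h5 : A (y - z) = -((1 - t) • ((W y).2 - A (y - z))) := by
      rw [← sub_eq_zero, ← h]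
      module
    have h6 : ‖A (y - z)‖ ≤ ‖(W y).2 - A (y - z)‖ := by
      conv_lhs => rw [h5, norm_neg, norm_smul, Real.norm_eq_abs, abs_of_nonneg (by linarith)]
      exact mul_le_of_le_one_left (norm_nonneg _) (by linarith)
    have h7 : k * ‖A (y - z)‖ ≤ k * (1 / (2 * k) * ‖y - z‖) := by
      gcongr
      exact h6.trans h3
    have h8 : k * (1 / (2 * k) * ‖y - z‖) = ‖y - z‖ / 2 := by field_simp
    linarith

/-- Cutting a box in eight. -/
lemma rep_eight {W : V → E4} {a b : V}
    (h : ∀ c : Fin 3 → Prop, [DecidablePred c] → Rep HZ fun s => W (pb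
      (fun i => if c i then (a i + b i) / 2 else a i)
      (fun i => if c i then b i else (a i + b i) / 2) s)) :
    Rep HZ fun s => W (pb a b s) := by
  have key : ∀ p q r : Bool, Rep HZ fun s => W (pb
      (fun i => if (![p, q, r] i = true) then (a i + b i) / 2 else a i)
      (fun i => if (![p, q, r] i = true) then b i else (a i + b i) / 2) s) :=
    fun p q r => h (fun i => ![p, q, r] i = true)
  refine Rep.cut 0 (Rep.cut 1 (Rep.cut 2 ?_ ?_) (Rep.cut 2 ?_ ?_))
    (Rep.cut 1 (Rep.cut 2 ?_ ?_) (Rep.cut 2 ?_ ?_))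
  · convert key false false false using 4 <;> ext i <;> fin_cases i <;> simp [Function.update]
  · convert key false false true using 4 <;> ext i <;> fin_cases i <;> simp [Function.update]
  · convert key false true false using 4 <;> ext i <;> fin_cases i <;> simp [Function.update]
  · convert key false true true using 4 <;> ext i <;> fin_cases i <;> simp [Function.update]
  · convert key true false false using 4 <;> ext i <;> fin_cases i <;> simp [Function.update]
  · convert key true false true using 4 <;> ext i <;> fin_cases i <;> simp [Function.update]
  · convert key true true false using 4 <;> ext i <;> fin_cases i <;> simp [Function.update]
  · convert key true true true using 4 <;> ext i <;> fin_cases i <;> simp [Function.update]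

lemma rep_all {W : V → E4} (hW : Continuous W) (hne : ∀ x, W x ≠ 0)
    (hZ : ∀ z, (W z).1 < 0 → (W z).2 = 0 → (∀ i, ∀ r : ℚ, z i ≠ r) ∧
      ∃ A : V →L[ℝ] V, HasFDerivAt (fun x => (W x).2) A z ∧
        LinearMap.det (A : V →ₗ[ℝ] V) ≠ 0) :
    Rep HZ (fun s => W (pb 0 1 s)) := by
  classical
  let p : BoxIntegral.Box (Fin 3) → Prop := fun J =>
    (∀ i, (∃ r : ℚ, J.lower i = r) ∧ ∃ r : ℚ, J.upper i = r) →
      Rep HZ (fun s => W (pb J.lower J.upper s))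
  let J0 : BoxIntegral.Box (Fin 3) := ⟨0, 1, fun i => by simp⟩
  have hp : p J0 := by
    refine BoxIntegral.Box.subbox_induction_on' J0 ?_ ?_
    · intro J hJ hs hr
      refine rep_eight fun c _ => ?_
      have h1 := hs {i | c i} (by
        intro i
        obtain ⟨⟨r1, h1⟩, ⟨r2, h2⟩⟩ := hr i
        simp only [BoxIntegral.Box.splitCenterBox, Set.piecewise]
        split_ifs
        · exact ⟨⟨(r1 + r2) / 2, by push_cast; rw [h1, h2]⟩, ⟨r2, h2⟩⟩
        · exact ⟨⟨r1, h1⟩, ⟨(r1 + r2) / 2, by push_cast; rw [h1, h2]⟩⟩)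
      convert h1 using 4
      · ext i
        simp [BoxIntegral.Box.splitCenterBox, Set.piecewise]
      · ext i
        simp [BoxIntegral.Box.splitCenterBox, Set.piecewise]
    · intro z _
      by_cases h : (W z).1 ≤ 0 ∧ (W z).2 = 0
      · have h1 : (W z).1 < 0 := lt_of_le_of_ne h.1 (fun h' => hne z (Prod.ext h' h.2))
        obtain ⟨hr, A, hd, hA⟩ := hZ z h1 h.2
        obtain ⟨U, hU, hU2⟩ := rep_local_zero hW h1 h.2 hd hA
        refine ⟨U, mem_nhdsWithin_of_mem_nhds hU, fun J _ _ hzJ hJU _ hJr => ?_⟩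
        refine hU2 _ _ J.lower_lt_upper hJU fun i => ?_
        obtain ⟨⟨r1, h1⟩, ⟨r2, h2⟩⟩ := hJr i
        refine ⟨lt_of_le_of_ne (hzJ.1 i) ?_, lt_of_le_of_ne (hzJ.2 i) ?_⟩
        · rw [h1]; exact (hr i r1).symm
        · rw [h2]; exact hr i r2
      · have hcl : IsClosed {y | (W y).1 ≤ 0 ∧ (W y).2 = 0} :=
          (isClosed_le (continuous_fst.comp hW) continuous_const).inter
            (isClosed_eq (continuous_snd.comp hW) continuous_const)
        refine ⟨_, mem_nhdsWithin_of_mem_nhds (hcl.isOpen_compl.mem_nhds h), ?_⟩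
        intro J _ _ hzJ hJU _ hJr
        refine Rep.trivial (by fun_prop) (fun s => hne _) fun s hs h' => ?_
        exact hJU (pb_mem J.lower_lt_upper s) ⟨hs.le, h'⟩
  exact hp fun i => ⟨⟨0, by simp [J0]⟩, ⟨1, by simp [J0]⟩⟩

end Pi3

open scoped unitInterval Topology Topology.Homotopy

namespace Pi3

open MeasureTheory in
/-- Sard: choice of a good direction. -/
lemma sard (g : V → E4) (hg : ContDiff ℝ 1 g) :
    ∃ p : V, ∀ z, (g z).1 < 0 → (g z).2 = (g z).1 • p → (∀ i, ∀ r : ℚ, z i ≠ r) ∧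
      ∃ A : V →L[ℝ] V, HasFDerivAt (fun x => (g x).2 - (g x).1 • p) A z ∧
        LinearMap.det (A : V →ₗ[ℝ] V) ≠ 0 := by
  let u : V → V := fun x => ((g x).1)⁻¹ • (g x).2
  let Om : Set V := {x | (g x).1 < 0}
  have hgd : Differentiable ℝ g := hg.differentiable one_ne_zero
  have hd1 : ∀ x, HasFDerivAt (fun x => (g x).1) ((ContinuousLinearMap.fst ℝ ℝ V).comp (fderiv ℝ g x)) x :=
    fun x => (hgd x).hasFDerivAt.fst
  have hd2 : ∀ x, HasFDerivAt (fun x => (g x).2) ((ContinuousLinearMap.snd ℝ ℝ V).comp (fderiv ℝ g x)) x :=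
    fun x => (hgd x).hasFDerivAt.snd
  have hu : ∀ x ∈ Om, DifferentiableAt ℝ u x := fun x hx =>
    ((hd1 x).differentiableAt.inv (ne_of_lt hx)).smul (hd2 x).differentiableAt
  let C : Set V := {x | x ∈ Om ∧ (fderiv ℝ u x).det = 0}
  let R : Set V := {x | x ∈ Om ∧ ∃ i, ∃ r : ℚ, x i = r}
  have hC : (volume : Measure V) (u '' C) = 0 :=
    addHaar_image_eq_zero_of_det_fderivWithin_eq_zero volume
      (fun x hx => (hu x hx.1).hasFDerivAt.hasFDerivWithinAt) (fun x hx => hx.2)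
  have hR0 : (volume : Measure V) R = 0 := by
    have : R ⊆ ⋃ i : Fin 3, ⋃ r : ℚ, {x : V | x i = r} := by
      rintro x ⟨-, i, r, h⟩
      simp only [Set.mem_iUnion]
      exact ⟨i, r, h⟩
    refine measure_mono_null this ?_
    refine measure_iUnion_null fun i => measure_iUnion_null fun r => ?_
    exact Measure.pi_hyperplane _ i _
  have hR : (volume : Measure V) (u '' R) = 0 :=
    addHaar_image_eq_zero_of_differentiableOn_of_addHaar_eq_zero volume
      (fun x hx => (hu x hx.1).differentiableWithinAt) hR0
  have hex : ∃ p, p ∉ u '' C ∪ u '' R := by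
    by_contra! h
    have h1 : (volume : Measure V) (u '' C ∪ u '' R) = 0 := measure_union_null hC hR
    have h2 : u '' C ∪ u '' R = Set.univ := Set.eq_univ_of_forall h
    rw [h2] at h1
    exact (NeZero.ne (volume : Measure V)) (Measure.measure_univ_eq_zero.1 h1)
  obtain ⟨p, hp⟩ := hex
  rw [Set.mem_union, not_or] at hp
  refine ⟨p, fun z hz1 hz2 => ?_⟩
  have hzne : (g z).1 ≠ 0 := ne_of_lt hz1
  have huz : u z = p := by
    simp only [u]
    rw [hz2, smul_smul, inv_mul_cancel₀ hzne, one_smul]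
  refine ⟨fun i r h => hp.2 ⟨z, ⟨hz1, i, r, h⟩, huz⟩, ?_⟩
  have hdet : (fderiv ℝ u z).det ≠ 0 := fun h => hp.1 ⟨z, ⟨hz1, h⟩, huz⟩
  refine ⟨(g z).1 • fderiv ℝ u z, ?_, ?_⟩
  · have h1 : HasFDerivAt (fun x => (g x).1 • (u x - p)) ((g z).1 • fderiv ℝ u z) z := by
      have := (hd1 z).smul ((hu z hz1).hasFDerivAt.sub_const p)
      rw [huz, sub_self] at this
      have e0 : (g z).1 • fderiv ℝ u z +
          ((ContinuousLinearMap.fst ℝ ℝ V).comp (fderiv ℝ g z)).smulRight (0 : V) =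
          (g z).1 • fderiv ℝ u z := by
        ext v
        simp
      rw [e0] at this
      exact this
    refine h1.congr_of_eventuallyEq ?_
    have : ∀ᶠ x in 𝓝 z, (g x).1 < 0 :=
      (continuous_fst.comp hgd.continuous).continuousAt.eventually_lt continuousAt_const hz1
    filter_upwards [this] with x hx
    simp only [u]
    rw [smul_sub, smul_smul, mul_inv_cancel₀ (ne_of_lt hx), one_smul]
  · change LinearMap.det ((g z).1 • (fderiv ℝ u z : V →ₗ[ℝ] V)) ≠ 0
    rw [LinearMap.det_smul]
    exact mul_ne_zero (pow_ne_zero _ hzne) hdet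

/-- Coordinatewise clamping to the unit cube. -/
noncomputable def clamp (x : V) : Q := fun i => Set.projIcc 0 1 zero_le_one (x i)

@[fun_prop] lemma continuous_clamp : Continuous clamp :=
  continuous_pi fun i => continuous_projIcc.comp (continuous_apply i)

lemma clamp_pb (s : Q) : clamp (pb 0 1 s) = s := by
  funext i
  have : pb 0 1 s i = s i := by simp [pb]
  simp only [clamp, this]
  exact Set.projIcc_val zero_le_one (s i)

/-- Loops that are joined by a path of nonvanishing functions. -/
lemma cl_eq_of_fun {f g : GenLoop (Fin 3) Y4 y0} (h : I × Q → E4) (hc : Continuous h)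
    (hne : ∀ q, h q ≠ 0) (h0 : ∀ s, h (0, s) = (f s).1) (h1 : ∀ s, h (1, s) = (g s).1)
    (hb : ∀ t, ∀ s ∈ Cube.boundary (Fin 3), h (t, s) = b0) : cl f = cl g :=
  cl_eq_of_homotopy ⟨fun q => ⟨h q, hne q⟩, hc.subtype_mk _⟩ (fun s => Subtype.ext (h0 s))
    (fun s => Subtype.ext (h1 s)) (fun t s hs => Subtype.ext (hb t s hs))

/-- A loop from a nonvanishing function. -/
noncomputable def mkL (w : Q → E4) (hw : Continuous w) (hne : ∀ s, w s ≠ 0)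
    (hb : ∀ s ∈ Cube.boundary (Fin 3), w s = b0) : GenLoop (Fin 3) Y4 y0 :=
  ⟨⟨fun s => ⟨w s, hne s⟩, hw.subtype_mk _⟩, fun s hs => Subtype.ext (hb s hs)⟩

/-- Shearing of the lower half space. -/
noncomputable def shear (p : V) (v : E4) : E4 := (v.1, v.2 - (min v.1 0) • p)

lemma shear_ne (p : V) {v : E4} (hv : v ≠ 0) : shear p v ≠ 0 := by
  intro h
  have h1 : v.1 = 0 := congrArg Prod.fst h
  have h2 : v.2 - (min v.1 0) • p = 0 := congrArg Prod.snd h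
  rw [h1] at h2
  simp at h2
  exact hv (Prod.ext h1 h2)

lemma shear_b0 (p : V) : shear p b0 = b0 := by simp [shear, b0]

lemma shear_zero (v : E4) : shear 0 v = v := by simp [shear]

lemma exists_lower {X : Type*} [TopologicalSpace X] [CompactSpace X] (f : X → E4)
    (hf : Continuous f) (hne : ∀ x, f x ≠ 0) : ∃ m > 0, ∀ x, m ≤ ‖f x‖ := by
  rcases isEmpty_or_nonempty X with h | h
  · exact ⟨1, one_pos, fun x => h.elim x⟩
  · obtain ⟨x, hx⟩ := hf.norm.exists_forall_le' (x₀ := Classical.arbitrary X) (by simp)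
    exact ⟨‖f x‖, norm_pos_iff.2 (hne x), hx⟩

theorem mem_HZ (c : P3) : c ∈ HZ := by
  obtain ⟨f, rfl⟩ := cl_surj c
  have hfc : Continuous fun s => (f s).1 := continuous_subtype_val.comp f.1.continuous
  obtain ⟨m, hm0, hm⟩ := exists_lower (fun s => (f s).1) hfc (fun s => (f s).2)
  let F : V → E4 := fun x => (f (clamp x)).1
  have hF : Continuous F := hfc.comp continuous_clamp
  obtain ⟨g, hg, hgF, -⟩ := hF.exists_contDiff_approx 1 (ε := fun _ => min (m / 2) (1 / 4))
    continuous_const (fun _ => by positivity)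
  let χ : V → ℝ := fun x => max 0 (min 1 (2 * (1 - (F x).1)))
  have hχ : Continuous χ := by
    have : Continuous fun x => (F x).1 := continuous_fst.comp hF
    fun_prop
  have hχ0 : ∀ x, 0 ≤ χ x := fun x => le_max_left _ _
  have hχ1 : ∀ x, χ x ≤ 1 := fun x => max_le zero_le_one (min_le_left _ _)
  have hgc : Continuous g := hg.continuous
  have hsm : ∀ t : ℝ, 0 ≤ t → t ≤ 1 → ∀ x, F x + (t * χ x) • (g x - F x) ≠ 0 := by
    intro t h0 h1 x h
    have h2 : ‖F x‖ = ‖(t * χ x) • (g x - F x)‖ := by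
      rw [← norm_neg ((t * χ x) • (g x - F x)), ← eq_neg_of_add_eq_zero_left h]
    have h3 : ‖g x - F x‖ < m / 2 := by
      rw [← dist_eq_norm_sub]; exact (hgF x).trans_le (min_le_left _ _)
    have h4 : m ≤ ‖F x‖ := hm _
    rw [norm_smul, Real.norm_eq_abs, abs_of_nonneg (mul_nonneg h0 (hχ0 x))] at h2
    have h5 : t * χ x ≤ 1 := mul_le_one₀ h1 (hχ0 x) (hχ1 x)
    have h6 : t * χ x * ‖g x - F x‖ ≤ ‖g x - F x‖ :=
      mul_le_of_le_one_left (norm_nonneg _) h5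
    linarith
  let f1 : V → E4 := fun x => F x + χ x • (g x - F x)
  have hf1c : Continuous f1 := by fun_prop
  have hf1ne : ∀ x, f1 x ≠ 0 := fun x => by
    have := hsm 1 zero_le_one le_rfl x
    rwa [one_mul] at this
  have hFb : ∀ s ∈ Cube.boundary (Fin 3), F (pb 0 1 s) = b0 := by
    intro s hs
    simp only [F, clamp_pb]
    exact congrArg Subtype.val (f.2 s hs)
  have hχb : ∀ s ∈ Cube.boundary (Fin 3), χ (pb 0 1 s) = 0 := by
    intro s hs
    simp only [χ, hFb s hs]
    simp [b0]
  obtain ⟨p, hp⟩ := sard g hg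
  let W : V → E4 := fun x => shear p (f1 x)
  have hWc : Continuous W := by
    simp only [W, shear]
    fun_prop
  have hWne : ∀ x, W x ≠ 0 := fun x => shear_ne p (hf1ne x)
  have hf1b : ∀ s ∈ Cube.boundary (Fin 3), f1 (pb 0 1 s) = b0 := by
    intro s hs
    simp only [f1]
    rw [hFb s hs, hχb s hs]
    simp
  have hWb : ∀ s ∈ Cube.boundary (Fin 3), W (pb 0 1 s) = b0 := by
    intro s hs
    simp only [W]
    rw [hf1b s hs, shear_b0]
  have hrep : Rep HZ (fun s => W (pb 0 1 s)) := by
    refine rep_all hWc hWne fun z hz1 hz2 => ?_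
    have hloc : (f1 z).1 < 0 → (F z).1 < 1 / 2 := by
      intro h
      by_contra! h'
      have h1 : ‖(g z - F z).1‖ ≤ ‖g z - F z‖ := norm_fst_le _
      have h2 : ‖g z - F z‖ < 1 / 4 := by
        rw [← dist_eq_norm_sub]; exact (hgF z).trans_le (min_le_right _ _)
      have h3 : (f1 z).1 = (F z).1 + χ z * (g z - F z).1 := rfl
      have h4 : |χ z * (g z - F z).1| ≤ 1 / 4 := by
        rw [abs_mul, abs_of_nonneg (hχ0 z)]
        have : χ z * |(g z - F z).1| ≤ |(g z - F z).1| :=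
          mul_le_of_le_one_left (abs_nonneg _) (hχ1 z)
        rw [Real.norm_eq_abs] at h1
        linarith
      have := (abs_le.1 h4).1
      linarith
    have hz1' : (f1 z).1 < 0 := hz1
    have ev1 : ∀ᶠ x in 𝓝 z, f1 x = g x := by
      have : ∀ᶠ x in 𝓝 z, (F x).1 < 1 / 2 :=
        (continuous_fst.comp hF).continuousAt.eventually_lt continuousAt_const (hloc hz1')
      filter_upwards [this] with x hx
      have : χ x = 1 := by
        simp only [χ]
        rw [min_eq_left (by linarith), max_eq_right zero_le_one]
      simp only [f1, this, one_smul]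
      abel
    have ev2 : ∀ᶠ x in 𝓝 z, (f1 x).1 < 0 :=
      (continuous_fst.comp hf1c).continuousAt.eventually_lt continuousAt_const hz1'
    have ev3 : (fun x => (W x).2) =ᶠ[𝓝 z] fun x => (g x).2 - (g x).1 • p := by
      filter_upwards [ev1, ev2] with x h1 h2
      simp only [W, shear]
      rw [min_eq_left h2.le, h1]
    have hgz : f1 z = g z := ev1.self_of_nhds
    obtain ⟨hr, A, hA, hA'⟩ := hp z (by rw [← hgz]; exact hz1') (by
      have : (W z).2 = (g z).2 - (g z).1 • p := ev3.self_of_nhds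
      rw [hz2] at this
      exact sub_eq_zero.1 this.symm)
    exact ⟨hr, A, hA.congr_of_eventuallyEq ev3, hA'⟩
  obtain ⟨l0, hl0⟩ := hrep
  obtain ⟨k, hk, hkH⟩ := hl0 l0 le_rfl
  let L1 := mkL (fun s => f1 (pb 0 1 s)) (by fun_prop) (fun s => hf1ne _) hf1b
  let L2 := mkL (fun s => W (pb 0 1 s)) (by fun_prop) (fun s => hWne _) hWb
  have e1 : cl f = cl L1 := by
    refine cl_eq_of_fun (fun q => F (pb 0 1 q.2) + ((q.1 : ℝ) * χ (pb 0 1 q.2)) •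
      (g (pb 0 1 q.2) - F (pb 0 1 q.2))) (by fun_prop) (fun q => hsm _ q.1.2.1 q.1.2.2 _)
      (fun s => ?_) (fun s => ?_) (fun t s hs => ?_)
    · simp [F, clamp_pb]
    · simp
      rfl
    · simp [hFb s hs, hχb s hs]
  have e2 : cl L1 = cl L2 := by
    refine cl_eq_of_fun (fun q => shear ((q.1 : ℝ) • p) (f1 (pb 0 1 q.2))) ?_
      (fun q => shear_ne _ (hf1ne _)) (fun s => ?_) (fun s => ?_) (fun t s hs => ?_)
    · simp only [shear]
      fun_prop
    · simp [shear_zero]; rfl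
    · simp; rfl
    · simp [hf1b s hs, shear_b0]
  have e3 : cl L2 = cl k := by
    refine cl_eq_of_fun (fun q => (1 - (q.1 : ℝ)) • W (pb 0 1 q.2) +
      (q.1 : ℝ) • K l0 (W (pb 0 1 q.2))) ?_
      (fun q => K_line (hWne _) _ q.1.2.1 q.1.2.2) (fun s => ?_) (fun s => ?_) (fun t s hs => ?_)
    · have : Continuous fun q : I × Q => K l0 (W (pb 0 1 q.2)) :=
        K_cont continuous_const (by fun_prop) (fun q => hWne _)
      fun_prop
    · simp; rfl
    · simp [hk]
    · have : K l0 b0 = b0 := K_eq_b0 (by simp [b0])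
      simp only [hWb s hs, this]
      rw [← add_smul]; simp
  rw [e1, e2, e3]
  exact hkH

end Pi3

open scoped unitInterval Topology Topology.Homotopy
namespace Pi3

abbrev R4 := Fin 4 → ℝ

noncomputable def chi (s : ℝ) : ℝ := expNegInvGlue (-s - 98/100)

theorem chi_smooth : ContDiff ℝ ((⊤ : ℕ∞) : WithTop ℕ∞) chi :=
  expNegInvGlue.contDiff.comp (by fun_prop)

theorem chi_zero {s : ℝ} (h : -(98/100) ≤ s) : chi s = 0 :=
  expNegInvGlue.zero_of_nonpos (by linarith)

theorem chi_pos {s : ℝ} (h : s < -(98/100)) : 0 < chi s :=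
  expNegInvGlue.pos_of_pos (by linarith)

theorem chi_nonneg (s : ℝ) : 0 ≤ chi s := expNegInvGlue.nonneg _

def det3 (u v w : R4) : ℝ :=
  u 1 * (v 2 * w 3 - v 3 * w 2) - u 2 * (v 1 * w 3 - v 3 * w 1) + u 3 * (v 1 * w 2 - v 2 * w 1)

noncomputable def dens (w : V → R4) (x : V) : ℝ :=
  chi (w x 0) * det3 (fderiv ℝ w x (Pi.single 0 1)) (fderiv ℝ w x (Pi.single 1 1))
    (fderiv ℝ w x (Pi.single 2 1))

theorem hasDerivAt_det3 {u v w : ℝ → R4} {u' v' w' : R4} {s : ℝ}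
    (hu : HasDerivAt u u' s) (hv : HasDerivAt v v' s) (hw : HasDerivAt w w' s) :
    HasDerivAt (fun t => det3 (u t) (v t) (w t))
      (det3 u' (v s) (w s) + det3 (u s) v' (w s) + det3 (u s) (v s) w') s := by
  rw [hasDerivAt_pi] at hu hv hw
  unfold det3
  have := (((hu 1).mul (((hv 2).mul (hw 3)).sub ((hv 3).mul (hw 2)))).sub
    ((hu 2).mul (((hv 1).mul (hw 3)).sub ((hv 3).mul (hw 1))))).add
    ((hu 3).mul (((hv 1).mul (hw 2)).sub ((hv 2).mul (hw 1))))
  refine HasDerivAt.congr_deriv this ?_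
  simp only [Pi.mul_apply, Pi.sub_apply]
  ring

/-- partial derivative -/
noncomputable def pd (G : R4 → R4) (i : Fin 4) (q : R4) : R4 := fderiv ℝ G q (Pi.single i 1)

theorem pd_smooth {G : R4 → R4} (hG : ContDiff ℝ ((⊤ : ℕ∞) : WithTop ℕ∞) G) (i : Fin 4) :
    ContDiff ℝ ((⊤ : ℕ∞) : WithTop ℕ∞) (pd G i) := by
  unfold pd
  have : ContDiff ℝ ((⊤ : ℕ∞) : WithTop ℕ∞) (fderiv ℝ G) := hG.fderiv_right (by simp)
  fun_prop

theorem pd_symm {G : R4 → R4} (hG : ContDiff ℝ ((⊤ : ℕ∞) : WithTop ℕ∞) G) (i j : Fin 4) (q : R4) :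
    pd (pd G i) j q = pd (pd G j) i q := by
  have h1 : ContDiff ℝ ((⊤ : ℕ∞) : WithTop ℕ∞) (fderiv ℝ G) := hG.fderiv_right (by simp)
  have hd : DifferentiableAt ℝ (fderiv ℝ G) q := (h1.differentiable (by simp)) q
  have key : ∀ k l : Fin 4, pd (pd G k) l q
      = fderiv ℝ (fderiv ℝ G) q (Pi.single l 1) (Pi.single k 1) := by
    intro k l
    have : HasFDerivAt (fun p => fderiv ℝ G p (Pi.single k 1))
      ((ContinuousLinearMap.apply ℝ R4 (Pi.single k 1 : R4)).comp (fderiv ℝ (fderiv ℝ G) q)) q :=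
      (ContinuousLinearMap.apply ℝ R4 (Pi.single k 1 : R4)).hasFDerivAt.comp q hd.hasFDerivAt
    show fderiv ℝ (fun p => fderiv ℝ G p (Pi.single k 1)) q _ = _
    rw [this.fderiv]
    rfl
  rw [key, key]
  exact (hG.contDiffAt.isSymmSndFDerivAt (by
    simp only [minSmoothness_of_isRCLikeNormedField]
    exact WithTop.coe_le_coe.2 le_top)) _ _

theorem hasDerivAt_line {G : R4 → R4} (hG : ContDiff ℝ ((⊤ : ℕ∞) : WithTop ℕ∞) G) (i : Fin 4)
    (q : R4) : HasDerivAt (fun t : ℝ => G (q + t • Pi.single i 1)) (pd G i q) 0 := by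
  have h : HasFDerivAt G (fderiv ℝ G q) (q + (0 : ℝ) • (Pi.single i 1 : R4)) := by
    simpa using ((hG.differentiable (by simp)) q).hasFDerivAt
  have hl : HasDerivAt (fun t : ℝ => q + t • (Pi.single i 1 : R4)) (Pi.single i 1) 0 := by
    simpa using ((hasDerivAt_id (0 : ℝ)).smul_const (Pi.single i 1 : R4)).const_add q
  exact h.comp_hasDerivAt 0 hl

theorem hasDerivAt_line1 {G : R4 → R4} (hG : ContDiff ℝ ((⊤ : ℕ∞) : WithTop ℕ∞) G) (i : Fin 4)
    (q : R4) (a b c : Fin 4) :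
    HasDerivAt (fun t : ℝ => chi (G (q + t • Pi.single i 1) 0) *
        det3 (pd G a (q + t • Pi.single i 1)) (pd G b (q + t • Pi.single i 1))
          (pd G c (q + t • Pi.single i 1)))
      ((deriv chi (G q 0) * pd G i q 0) * det3 (pd G a q) (pd G b q) (pd G c q) +
        chi (G q 0) * (det3 (pd (pd G a) i q) (pd G b q) (pd G c q)
          + det3 (pd G a q) (pd (pd G b) i q) (pd G c q)
          + det3 (pd G a q) (pd G b q) (pd (pd G c) i q))) 0 := by
  have h0 := hasDerivAt_pi.1 (hasDerivAt_line hG i q) 0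
  have hc : HasDerivAt chi (deriv chi (G q 0)) (G (q + (0 : ℝ) • Pi.single i 1) 0) := by
    simpa using ((chi_smooth.differentiable (by simp)) (G q 0)).hasDerivAt
  have h1 := hc.comp (0 : ℝ) h0
  have h2 := h1.mul (hasDerivAt_det3 (hasDerivAt_line (pd_smooth hG a) i q)
    (hasDerivAt_line (pd_smooth hG b) i q) (hasDerivAt_line (pd_smooth hG c) i q))
  refine HasDerivAt.congr_deriv h2 ?_
  simp

noncomputable def VF (G : R4 → R4) (q : R4) : R4 :=
  ![chi (G q 0) * det3 (pd G 1 q) (pd G 2 q) (pd G 3 q),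
    -(chi (G q 0) * det3 (pd G 0 q) (pd G 2 q) (pd G 3 q)),
    chi (G q 0) * det3 (pd G 0 q) (pd G 1 q) (pd G 3 q),
    -(chi (G q 0) * det3 (pd G 0 q) (pd G 1 q) (pd G 2 q))]

theorem VFc_smooth {G : R4 → R4} (hG : ContDiff ℝ ((⊤ : ℕ∞) : WithTop ℕ∞) G) (a b c : Fin 4) :
    ContDiff ℝ ((⊤ : ℕ∞) : WithTop ℕ∞)
      (fun q => chi (G q 0) * det3 (pd G a q) (pd G b q) (pd G c q)) := by
  have h : ∀ i j, ContDiff ℝ ((⊤ : ℕ∞) : WithTop ℕ∞) (fun q => pd G i q j) :=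
    fun i j => (contDiff_pi.1 (pd_smooth hG i)) j
  have h0 : ContDiff ℝ ((⊤ : ℕ∞) : WithTop ℕ∞) (fun q => G q 0) := contDiff_pi.1 hG 0
  have h1 := chi_smooth.comp h0
  unfold det3
  exact h1.mul ((((h a 1).mul (((h b 2).mul (h c 3)).sub ((h b 3).mul (h c 2)))).sub
    ((h a 2).mul (((h b 1).mul (h c 3)).sub ((h b 3).mul (h c 1))))).add
    ((h a 3).mul (((h b 1).mul (h c 2)).sub ((h b 2).mul (h c 1)))))

theorem VF_smooth {G : R4 → R4} (hG : ContDiff ℝ ((⊤ : ℕ∞) : WithTop ℕ∞) G) :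
    ContDiff ℝ ((⊤ : ℕ∞) : WithTop ℕ∞) (VF G) := by
  rw [contDiff_pi]
  intro i
  fin_cases i
  · exact VFc_smooth hG 1 2 3
  · exact (VFc_smooth hG 0 2 3).neg
  · exact VFc_smooth hG 0 1 3
  · exact (VFc_smooth hG 0 1 2).neg

theorem VF_fderiv {G : R4 → R4} (hG : ContDiff ℝ ((⊤ : ℕ∞) : WithTop ℕ∞) G) (q : R4) (i : Fin 4)
    {d : ℝ} (h : HasDerivAt (fun t : ℝ => VF G (q + t • Pi.single i 1) i) d 0) :
    fderiv ℝ (VF G) q (Pi.single i 1) i = d := by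
  have := hasDerivAt_pi.1 (hasDerivAt_line (VF_smooth hG) i q) i
  exact this.unique h

theorem det4_zero {g d0 d1 d2 d3 : R4} (hg : ∑ a, g a ^ 2 = 1)
    (h0 : ∑ a, g a * d0 a = 0) (h1 : ∑ a, g a * d1 a = 0) (h2 : ∑ a, g a * d2 a = 0)
    (h3 : ∑ a, g a * d3 a = 0) :
    d0 0 * det3 d1 d2 d3 - d1 0 * det3 d0 d2 d3 + d2 0 * det3 d0 d1 d3 - d3 0 * det3 d0 d1 d2
      = 0 := by
  let M : Matrix (Fin 4) (Fin 4) ℝ := Matrix.of ![d0, d1, d2, d3]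
  have hM : M.det = 0 := by
    apply Matrix.exists_mulVec_eq_zero_iff.1
    refine ⟨g, ?_, ?_⟩
    · rintro rfl
      simp at hg
    · ext i
      simp only [Matrix.mulVec, dotProduct, Pi.zero_apply]
      fin_cases i
      · simpa [M, mul_comm] using h0
      · simpa [M, mul_comm] using h1
      · simpa [M, mul_comm] using h2
      · simpa [M, mul_comm] using h3
  rw [Matrix.det_succ_column_zero] at hM
  simp only [Fin.sum_univ_four, Matrix.det_fin_three, Matrix.submatrix_apply] at hM
  simp [M, Fin.succAbove] at hM
  unfold det3
  linear_combination hM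

theorem VF_div {G : R4 → R4} (hG : ContDiff ℝ ((⊤ : ℕ∞) : WithTop ℕ∞) G)
    (h1 : ∀ q, ∑ a, G q a ^ 2 = 1) (q : R4) :
    ∑ i, fderiv ℝ (VF G) q (Pi.single i 1) i = 0 := by
  have e0 := VF_fderiv hG q 0 (hasDerivAt_line1 hG 0 q 1 2 3)
  have e1 := VF_fderiv hG q 1 (hasDerivAt_line1 hG 1 q 0 2 3).neg
  have e2 := VF_fderiv hG q 2 (hasDerivAt_line1 hG 2 q 0 1 3)
  have e3 := VF_fderiv hG q 3 (hasDerivAt_line1 hG 3 q 0 1 2).neg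
  rw [Fin.sum_univ_four, e0, e1, e2, e3]
  have hort : ∀ i, ∑ a, G q a * pd G i q a = 0 := by
    intro i
    have hl := hasDerivAt_pi.1 (hasDerivAt_line hG i q)
    have hs : HasDerivAt (fun t : ℝ => ∑ a, G (q + t • Pi.single i 1) a ^ 2)
        (∑ a, 2 * (G q a * pd G i q a)) 0 := by
      apply HasDerivAt.fun_sum
      intro a _
      have := (hl a).pow 2
      refine HasDerivAt.congr_deriv this ?_
      simp
      ring
    have hc : HasDerivAt (fun t : ℝ => ∑ a, G (q + t • Pi.single i 1) a ^ 2) 0 0 := by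
      simp only [h1]
      exact hasDerivAt_const _ _
    have := hs.unique hc
    rw [← Finset.mul_sum] at this
    linarith
  have hdet := det4_zero (h1 q) (hort 0) (hort 1) (hort 2) (hort 3)
  rw [pd_symm hG 1 0, pd_symm hG 2 0, pd_symm hG 3 0, pd_symm hG 2 1, pd_symm hG 3 1,
    pd_symm hG 3 2]
  have hswap : ∀ u v w : R4, det3 u v w = - det3 v u w := by intros; unfold det3; ring
  generalize pd G 0 q = d0 at *
  generalize pd G 1 q = d1 at *
  generalize pd G 2 q = d2 at *
  generalize pd G 3 q = d3 at *
  generalize pd (pd G 0) 1 q = d01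
  generalize pd (pd G 0) 2 q = d02
  generalize pd (pd G 0) 3 q = d03
  generalize pd (pd G 1) 2 q = d12
  generalize pd (pd G 1) 3 q = d13
  generalize pd (pd G 2) 3 q = d23
  have hc : (det3 d01 d2 d3 + det3 d1 d02 d3 + det3 d1 d2 d03)
    - (det3 d01 d2 d3 + det3 d0 d12 d3 + det3 d0 d2 d13)
    + (det3 d02 d1 d3 + det3 d0 d12 d3 + det3 d0 d1 d23)
    - (det3 d03 d1 d2 + det3 d0 d13 d2 + det3 d0 d1 d23) = 0 := by
    unfold det3; ring
  linear_combination (deriv chi (G q 0)) * hdet + chi (G q 0) * hc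

theorem insert_hasFDeriv (c : ℝ) (x : V) (j : Fin 3) :
    ∀ {G : R4 → R4}, ContDiff ℝ ((⊤ : ℕ∞) : WithTop ℕ∞) G →
    fderiv ℝ (fun x : V => G (Fin.insertNth (0 : Fin 4) c x)) x (Pi.single j 1)
      = pd G j.succ (Fin.insertNth (0 : Fin 4) c x) := by
  intro G hG
  let L : V →L[ℝ] R4 := ContinuousLinearMap.pi
    (Fin.cons 0 (fun i => ContinuousLinearMap.proj i))
  have hL : (fun x : V => (Fin.insertNth (0 : Fin 4) c x : R4)) =
      fun x => L x + (Pi.single 0 c : R4) := by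
    ext y i
    refine Fin.cases ?_ (fun i => ?_) i
    · simp [L]
    · simp [L]
  have h : HasFDerivAt (fun x : V => (Fin.insertNth (0 : Fin 4) c x : R4)) L x := by
    rw [hL]
    exact L.hasFDerivAt.add_const _
  have h2 : HasFDerivAt G (fderiv ℝ G (Fin.insertNth (0 : Fin 4) c x : R4))
    (Fin.insertNth (0 : Fin 4) c x : R4) := ((hG.differentiable (by simp)) _).hasFDerivAt
  have h3 := h2.comp x h
  have : fderiv ℝ (fun x : V => G (Fin.insertNth (0 : Fin 4) c x)) x = _ := h3.fderiv
  rw [this]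
  simp only [ContinuousLinearMap.comp_apply, pd]
  congr 1
  ext i
  refine Fin.cases ?_ (fun i => ?_) i
  · simp [L]
  · simp [L, Pi.single_apply]

theorem dens_insert (c : ℝ) (x : V) {G : R4 → R4} (hG : ContDiff ℝ ((⊤ : ℕ∞) : WithTop ℕ∞) G) :
    dens (fun x : V => G (Fin.insertNth (0 : Fin 4) c x)) x
      = VF G (Fin.insertNth (0 : Fin 4) c x) 0 := by
  unfold dens
  rw [insert_hasFDeriv c x 0 hG, insert_hasFDeriv c x 1 hG, insert_hasFDeriv c x 2 hG]
  rfl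

theorem VF_zero {G : R4 → R4} {q : R4} (h : -(98/100) ≤ G q 0) : VF G q = 0 := by
  unfold VF
  rw [chi_zero h]
  ext i
  fin_cases i <;> simp

theorem invariance {G : R4 → R4} (hG : ContDiff ℝ ((⊤ : ℕ∞) : WithTop ℕ∞) G)
    (h1 : ∀ q, ∑ a, G q a ^ 2 = 1)
    (hs : ∀ q : R4, ∀ i : Fin 3, (q i.succ = 0 ∨ q i.succ = 1) → -(98/100) ≤ G q 0) :
    ∫ x in Set.Icc (0 : V) 1, dens (fun x : V => G (Fin.insertNth (0 : Fin 4) 0 x)) x =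
    ∫ x in Set.Icc (0 : V) 1, dens (fun x : V => G (Fin.insertNth (0 : Fin 4) 1 x)) x := by
  have hVF := VF_smooth hG
  have key := MeasureTheory.integral_divergence_of_hasFDerivAt_off_countable (E := ℝ) (n := 3)
    (0 : R4) 1 zero_le_one (VF G) (fun q => fderiv ℝ (VF G) q) ∅ Set.countable_empty
    hVF.continuous.continuousOn
    (fun q _ => ((hVF.differentiable (by simp)) q).hasFDerivAt)
    (by
      simp only [VF_div hG h1]
      exact MeasureTheory.integrableOn_zero)
  simp only [VF_div hG h1, MeasureTheory.integral_zero] at key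
  rw [Fin.sum_univ_succ] at key
  have hz : ∀ i : Fin 3, ∀ c : ℝ, (c = 0 ∨ c = 1) → ∀ x : V,
      VF G (Fin.insertNth i.succ c x) i.succ = 0 := by
    intro i c hc x
    rw [VF_zero]
    · rfl
    · apply hs _ i
      simpa using hc
  have hz0 : ∀ i : Fin 3, ∀ x : V, VF G (Fin.insertNth i.succ ((0 : R4) i.succ) x) i.succ = 0 :=
    fun i x => hz i _ (Or.inl rfl) x
  have hz1 : ∀ i : Fin 3, ∀ x : V, VF G (Fin.insertNth i.succ ((1 : R4) i.succ) x) i.succ = 0 :=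
    fun i x => hz i _ (Or.inr rfl) x
  simp only [hz0, hz1, MeasureTheory.integral_zero, sub_zero, Finset.sum_const_zero,
    add_zero] at key
  simp only [dens_insert _ _ hG]
  exact (sub_eq_zero.1 key.symm).symm

end Pi3

open scoped unitInterval Topology Topology.Homotopy
namespace Pi3

noncomputable def nN (v : E4) : ℝ := v.1 ^ 2 + ∑ i, v.2 i ^ 2

theorem nN_pos {v : E4} (hv : v ≠ 0) : 0 < nN v := by
  by_contra h
  apply hv
  have h0 : nN v ≤ 0 := not_lt.1 h
  unfold nN at h0
  have hs : ∀ i ∈ Finset.univ, 0 ≤ v.2 i ^ 2 := fun i _ => sq_nonneg _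
  have h1 : v.1 ^ 2 = 0 := by
    have := Finset.sum_nonneg hs
    nlinarith [sq_nonneg v.1]
  have h2 : ∑ i, v.2 i ^ 2 = 0 := by
    have := Finset.sum_nonneg hs
    nlinarith [sq_nonneg v.1]
  rw [Finset.sum_eq_zero_iff_of_nonneg hs] at h2
  refine Prod.ext (by simpa using h1) ?_
  ext i
  simpa using h2 i (Finset.mem_univ _)

/-- Normalization to the unit sphere. -/
noncomputable def nz (v : E4) : R4 := fun a => (Fin.cons v.1 v.2 : R4) a / √(nN v)

theorem nz_zero (v : E4) : nz v 0 = v.1 / √(nN v) := rfl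
theorem nz_succ (v : E4) (i : Fin 3) : nz v i.succ = v.2 i / √(nN v) := rfl

theorem nz_sq {v : E4} (hv : v ≠ 0) : ∑ a, nz v a ^ 2 = 1 := by
  have h := nN_pos hv
  rw [Fin.sum_univ_succ]
  simp only [nz_zero, nz_succ, div_pow, Real.sq_sqrt h.le]
  rw [← Finset.sum_div, ← add_div]
  exact div_self h.ne'

theorem nz_b0 : nz b0 0 = 1 := by
  simp [nz_zero, nN, b0]

theorem contDiff_nz {E : Type*} [NormedAddCommGroup E] [NormedSpace ℝ E] {g : E → E4}
    (hg : ContDiff ℝ ((⊤ : ℕ∞) : WithTop ℕ∞) g) (hne : ∀ x, g x ≠ 0) :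
    ContDiff ℝ ((⊤ : ℕ∞) : WithTop ℕ∞) (fun x => nz (g x)) := by
  have h1 : ContDiff ℝ ((⊤ : ℕ∞) : WithTop ℕ∞) (fun x => (g x).1) := hg.fst
  have h2 : ∀ i, ContDiff ℝ ((⊤ : ℕ∞) : WithTop ℕ∞) (fun x => (g x).2 i) :=
    fun i => contDiff_pi.1 hg.snd i
  have hN : ContDiff ℝ ((⊤ : ℕ∞) : WithTop ℕ∞) (fun x => nN (g x)) := by
    unfold nN
    exact (h1.pow 2).add (ContDiff.sum fun i _ => (h2 i).pow 2)
  have hS := hN.sqrt (fun x => (nN_pos (hne x)).ne')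
  have hS0 : ∀ x, √(nN (g x)) ≠ 0 := fun x => (Real.sqrt_pos.2 (nN_pos (hne x))).ne'
  rw [contDiff_pi]
  intro a
  refine Fin.cases ?_ (fun i => ?_) a
  · exact h1.div hS hS0
  · exact (h2 i).div hS hS0

structure Sm (g : V → E4) : Prop where
  smooth : ContDiff ℝ ((⊤ : ℕ∞) : WithTop ℕ∞) g
  ne : ∀ x, g x ≠ 0
  bd : ∀ x i, (x i ≤ 0 ∨ 1 ≤ x i) → g x = b0

noncomputable def lp {g : V → E4} (hg : Sm g) : GenLoop (Fin 3) Y4 y0 :=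
  mkL (fun s => g (pb 0 1 s)) (hg.smooth.continuous.comp (pb_cont 0 1)) (fun s => hg.ne _)
    (by
      rintro s ⟨i, hi⟩
      apply hg.bd _ i
      rcases hi with hi | hi
      · left; simp [pb, hi]
      · right; simp [pb, hi])

noncomputable def D (g : V → E4) : ℝ := ∫ x in Set.Icc (0 : V) 1, dens (fun x => nz (g x)) x

theorem Sm.clamp_eq {g : V → E4} (hg : Sm g) (x : V) : g (pb 0 1 (clamp x)) = g x := by
  have hp : ∀ i, pb 0 1 (clamp x) i = max 0 (min 1 (x i)) := by
    intro i
    simp [pb, clamp, Set.coe_projIcc]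
  by_cases h : ∃ i, x i ≤ 0 ∨ 1 ≤ x i
  · obtain ⟨i, hi⟩ := h
    rw [hg.bd x i hi, hg.bd _ i]
    rw [hp]
    rcases hi with hi | hi
    · left
      simp [hi]
    · right
      simp [hi]
  · push Not at h
    congr 1
    ext i
    rw [hp, min_eq_right (h i).2.le, max_eq_right (h i).1.le]

theorem D_eq {f g : V → E4} (hf : Sm f) (hg : Sm g) (h : cl (lp hf) = cl (lp hg)) :
    D f = D g := by
  rw [cl_eq_iff] at h
  obtain ⟨H⟩ := h
  obtain ⟨m, hm, hlow⟩ := exists_lower (fun p : I × Q => (H p).1)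
    (continuous_subtype_val.comp H.continuous) (fun p => (H p).2)
  let tl : R4 → V := fun q i => q i.succ
  have htl : ContDiff ℝ ((⊤ : ℕ∞) : WithTop ℕ∞) tl := by
    rw [contDiff_pi]
    intro i
    exact contDiff_apply ℝ ℝ i.succ
  let Ht : R4 → E4 := fun q =>
    (H (Set.projIcc 0 1 zero_le_one (3 * q 0 - 1), clamp (tl q))).1
  have hHc : Continuous Ht := by
    refine continuous_subtype_val.comp (H.continuous.comp ?_)
    refine Continuous.prodMk (continuous_projIcc.comp (by fun_prop))
      (continuous_clamp.comp htl.continuous)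
  have h0 : ∀ q : R4, q 0 ≤ 1/3 → Ht q = f (tl q) := by
    intro q hq
    have : Set.projIcc (0 : ℝ) 1 zero_le_one (3 * q 0 - 1) = 0 :=
      Set.projIcc_of_le_left zero_le_one (by linarith)
    simp only [Ht, this]
    rw [H.apply_zero]
    exact hf.clamp_eq _
  have h1 : ∀ q : R4, 2/3 ≤ q 0 → Ht q = g (tl q) := by
    intro q hq
    have : Set.projIcc (0 : ℝ) 1 zero_le_one (3 * q 0 - 1) = 1 :=
      Set.projIcc_of_right_le zero_le_one (by linarith)
    simp only [Ht, this]
    rw [H.apply_one]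
    exact hg.clamp_eq _
  have hb : ∀ q : R4, ∀ i : Fin 3, (q i.succ = 0 ∨ q i.succ = 1) → Ht q = b0 := by
    intro q i hq
    have hbd : clamp (tl q) ∈ Cube.boundary (Fin 3) := by
      refine ⟨i, ?_⟩
      rcases hq with hq | hq
      · left
        exact Set.projIcc_of_le_left zero_le_one hq.le
      · right
        exact Set.projIcc_of_right_le zero_le_one hq.ge
    simp only [Ht]
    rw [H.eq_fst _ hbd]
    exact congrArg Subtype.val ((lp hf).2 _ hbd)
  have hA : IsOpen {q : R4 | q 0 < 1/3} := isOpen_lt (continuous_apply 0) continuous_const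
  have hB : IsOpen {q : R4 | 2/3 < q 0} := isOpen_lt continuous_const (continuous_apply 0)
  obtain ⟨G, hG, hGd, hGe, -⟩ := hHc.exists_contDiff_approx_and_eqOn (⊤ : ℕ∞)
    (ε := fun _ => min m (1/2)) continuous_const (fun _ => by positivity)
    (S := {q : R4 | q 0 ≤ 0} ∪ {q : R4 | 1 ≤ q 0})
    (U := {q : R4 | q 0 < 1/3} ∪ {q : R4 | 2/3 < q 0})
    ((isClosed_le (continuous_apply 0) continuous_const).union
      (isClosed_le continuous_const (continuous_apply 0)))
    ((hA.union hB).mem_nhdsSet.2 (by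
      rintro q (hq | hq)
      · left
        have : q 0 ≤ 0 := hq
        show q 0 < 1/3
        linarith
      · right
        have : 1 ≤ q 0 := hq
        show 2/3 < q 0
        linarith))
    (by
      refine ContDiffOn.union_of_isOpen ?_ ?_ hA hB
      · exact (hf.smooth.comp htl).contDiffOn.congr (fun q hq => h0 q (le_of_lt hq))
      · exact (hg.smooth.comp htl).contDiffOn.congr (fun q hq => h1 q (le_of_lt hq)))
  have hGne : ∀ q, G q ≠ 0 := by
    intro q hq
    have h2 := lt_of_lt_of_le (hGd q) (min_le_left _ _)
    rw [hq, dist_zero_left] at h2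
    exact absurd (hlow _) (not_le.2 h2)
  have hG1 := contDiff_nz hG hGne
  have hinv := invariance hG1 (fun q => nz_sq (hGne q)) (by
    intro q i hq
    have h2 := lt_of_lt_of_le (hGd q) (min_le_right _ _)
    rw [hb q i hq, dist_eq_norm] at h2
    have h3 : |(G q).1 - 1| ≤ ‖G q - b0‖ := norm_fst_le (G q - b0)
    have h4 := abs_lt.1 (lt_of_le_of_lt h3 h2)
    rw [nz_zero]
    have : 0 ≤ (G q).1 / √(nN (G q)) := div_nonneg (by linarith [h4.1]) (Real.sqrt_nonneg _)
    linarith)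
  have e0 : ∀ x : V, G (Fin.insertNth (0 : Fin 4) 0 x) = f x := by
    intro x
    have h2 := hGe (x := (Fin.insertNth (0 : Fin 4) 0 x : R4)) (Or.inl (by
      show (Fin.insertNth (0 : Fin 4) (0 : ℝ) x : R4) 0 ≤ 0
      simp))
    rw [h2, h0 _ (by simp)]
    rfl
  have e1 : ∀ x : V, G (Fin.insertNth (0 : Fin 4) 1 x) = g x := by
    intro x
    have h2 := hGe (x := (Fin.insertNth (0 : Fin 4) 1 x : R4)) (Or.inr (by
      show 1 ≤ (Fin.insertNth (0 : Fin 4) (1 : ℝ) x : R4) 0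
      simp))
    rw [h2, h1 _ (by simp; norm_num)]
    rfl
  simp only [e0, e1] at hinv
  exact hinv

end Pi3

open scoped unitInterval Topology Topology.Homotopy
namespace Pi3

theorem dens_congr {w w' : V → R4} {x : V} (h : w =ᶠ[𝓝 x] w') : dens w x = dens w' x := by
  unfold dens
  rw [h.fderiv_eq, h.eq_of_nhds]

theorem dens_continuous {w : V → R4} (hw : ContDiff ℝ ((⊤ : ℕ∞) : WithTop ℕ∞) w) :
    Continuous (dens w) := by
  have h : ∀ j : Fin 3, Continuous (fun x => fderiv ℝ w x (Pi.single j 1)) := by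
    intro j
    have : Continuous (fderiv ℝ w) := hw.continuous_fderiv (by simp)
    fun_prop
  have h' : ∀ j : Fin 3, ∀ a : Fin 4, Continuous (fun x => fderiv ℝ w x (Pi.single j 1) a) :=
    fun j a => (continuous_apply a).comp (h j)
  have h0 : Continuous (fun x => chi (w x 0)) :=
    chi_smooth.continuous.comp ((continuous_apply 0).comp hw.continuous)
  unfold dens det3
  exact h0.mul ((((h' 0 1).mul (((h' 1 2).mul (h' 2 3)).sub ((h' 1 3).mul (h' 2 2)))).sub
    ((h' 0 2).mul (((h' 1 1).mul (h' 2 3)).sub ((h' 1 3).mul (h' 2 1))))).add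
    ((h' 0 3).mul (((h' 1 1).mul (h' 2 2)).sub ((h' 1 2).mul (h' 2 1)))))

noncomputable abbrev dn (g : V → E4) : V → ℝ := dens (fun x => nz (g x))

theorem dn_b0 {g : V → E4} {x : V} (h : g x = b0) : dn g x = 0 := by
  unfold dn dens
  simp only [h, nz_b0]
  rw [chi_zero (by norm_num), zero_mul]

theorem Sm.dn_cont {g : V → E4} (hg : Sm g) : Continuous (dn g) :=
  dens_continuous (contDiff_nz hg.smooth hg.ne)

theorem Sm.dn_out {g : V → E4} (hg : Sm g) {x : V} (hx : x ∉ Set.Icc (0 : V) 1) : dn g x = 0 := by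
  by_cases h : ∃ i, x i ≤ 0 ∨ 1 ≤ x i
  · obtain ⟨i, hi⟩ := h
    exact dn_b0 (hg.bd x i hi)
  · push Not at h
    exact absurd ⟨fun i => (h i).1.le, fun i => (h i).2.le⟩ hx

theorem Sm.dn_cs {g : V → E4} (hg : Sm g) : HasCompactSupport (dn g) :=
  HasCompactSupport.intro isCompact_Icc (fun _ hx => hg.dn_out hx)

theorem Sm.dn_int {g : V → E4} (hg : Sm g) : MeasureTheory.Integrable (dn g) :=
  hg.dn_cont.integrable_of_hasCompactSupport hg.dn_cs

theorem Sm.D_full {g : V → E4} (hg : Sm g) : D g = ∫ x, dn g x :=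
  MeasureTheory.setIntegral_eq_integral_of_forall_compl_eq_zero (fun _ hx => hg.dn_out hx)

theorem dens_scale {w : V → R4} (hw : ContDiff ℝ ((⊤ : ℕ∞) : WithTop ℕ∞) w) (a x : V) :
    dens (fun x => w ((2 : ℝ) • x - a)) x = 8 * dens w ((2 : ℝ) • x - a) := by
  have hl : HasFDerivAt (fun x : V => (2 : ℝ) • x - a) ((2 : ℝ) • ContinuousLinearMap.id ℝ V) x :=
    ((hasFDerivAt_id x).const_smul (2 : ℝ)).sub_const a
  have h2 : HasFDerivAt w (fderiv ℝ w ((2 : ℝ) • x - a)) ((2 : ℝ) • x - a) :=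
    ((hw.differentiable (by simp)) _).hasFDerivAt
  have h3 : fderiv ℝ (fun x => w ((2 : ℝ) • x - a)) x = _ := (h2.comp x hl).fderiv
  have h4 : ∀ v : V, fderiv ℝ (fun x => w ((2 : ℝ) • x - a)) x v =
      (2 : ℝ) • fderiv ℝ w ((2 : ℝ) • x - a) v := by
    intro v
    rw [h3]
    simp
  unfold dens
  rw [h4, h4, h4]
  unfold det3
  simp only [Pi.smul_apply, smul_eq_mul]
  ring

noncomputable def e0 : V := Pi.single 0 1

noncomputable def dbl (g : V → E4) (x : V) : E4 :=
  g ((2 : ℝ) • x - 0) + g ((2 : ℝ) • x - e0) - b0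

theorem dbl_left {g : V → E4} (hg : Sm g) {x : V} (hx : x 0 ≤ 1/2) :
    dbl g x = g ((2 : ℝ) • x - 0) ∧ g ((2 : ℝ) • x - e0) = b0 := by
  have : g ((2 : ℝ) • x - e0) = b0 := by
    apply hg.bd _ 0
    left
    simp [e0]
    linarith
  refine ⟨?_, this⟩
  simp [dbl, this]

theorem dbl_right {g : V → E4} (hg : Sm g) {x : V} (hx : 1/2 ≤ x 0) :
    dbl g x = g ((2 : ℝ) • x - e0) ∧ g ((2 : ℝ) • x - 0) = b0 := by
  have : g ((2 : ℝ) • x - 0) = b0 := by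
    apply hg.bd _ 0
    right
    simp
    linarith
  refine ⟨?_, this⟩
  simp only [dbl, this]
  abel

theorem dbl_sm {g : V → E4} (hg : Sm g) : Sm (dbl g) := by
  refine ⟨?_, ?_, ?_⟩
  · have h : ∀ a : V, ContDiff ℝ ((⊤ : ℕ∞) : WithTop ℕ∞) (fun x => g ((2 : ℝ) • x - a)) := by
      intro a
      exact hg.smooth.comp ((contDiff_id.const_smul (2 : ℝ)).sub contDiff_const)
    exact ((h 0).add (h e0)).sub contDiff_const
  · intro x
    rcases le_total (x 0) (1/2) with h | h
    · rw [(dbl_left hg h).1]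
      exact hg.ne _
    · rw [(dbl_right hg h).1]
      exact hg.ne _
  · intro x i hi
    have he : e0 i = 0 ∨ e0 i = 1 ∧ i = 0 := by
      by_cases h : i = 0
      · right
        subst h
        simp [e0]
      · left
        simp [e0, h]
    have h1 : g ((2 : ℝ) • x - 0) = b0 := by
      apply hg.bd _ i
      simp only [Pi.sub_apply, Pi.smul_apply, smul_eq_mul, Pi.zero_apply]
      rcases hi with hi | hi
      · left; linarith
      · right; linarith
    have h2 : g ((2 : ℝ) • x - e0) = b0 := by
      apply hg.bd _ i
      simp only [Pi.sub_apply, Pi.smul_apply, smul_eq_mul]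
      rcases hi with hi | hi <;> rcases he with he | ⟨he, -⟩ <;> rw [he]
      · left; linarith
      · left; linarith
      · right; linarith
      · right; linarith
    simp only [dbl, h1, h2]
    abel

theorem dn_dbl {g : V → E4} (hg : Sm g) (x : V) :
    dn (dbl g) x = 8 * dn g ((2 : ℝ) • x - 0) + 8 * dn g ((2 : ℝ) • x - e0) := by
  have hs := contDiff_nz hg.smooth hg.ne
  rcases lt_trichotomy (x 0) (1/2) with h | h | h
  · rw [dn_b0 (dbl_left hg h.le).2, mul_zero, add_zero, ← dens_scale hs]
    apply dens_congr
    have : ∀ᶠ y : V in 𝓝 x, y 0 < 1/2 :=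
      (isOpen_lt (continuous_apply 0) continuous_const).mem_nhds h
    filter_upwards [this] with y hy
    rw [(dbl_left hg hy.le).1]
  · rw [dn_b0 (dbl_left hg h.le).2, dn_b0 (dbl_right hg h.ge).2, dn_b0]
    · simp
    · rw [(dbl_left hg h.le).1, (dbl_right hg h.ge).2]
  · rw [dn_b0 (dbl_right hg h.le).2, mul_zero, zero_add, ← dens_scale hs]
    apply dens_congr
    have : ∀ᶠ y : V in 𝓝 x, 1/2 < y 0 :=
      (isOpen_lt continuous_const (continuous_apply 0)).mem_nhds h
    filter_upwards [this] with y hy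
    rw [(dbl_right hg hy.le).1]

theorem int_scale {F : V → ℝ} (hF : MeasureTheory.Integrable F) (a : V) :
    MeasureTheory.Integrable (fun x => F ((2 : ℝ) • x - a)) ∧
    ∫ x, F ((2 : ℝ) • x - a) = (1/8) * ∫ x, F x := by
  constructor
  · have h1 : MeasureTheory.Integrable (fun y => F (y - a)) := hF.comp_sub_right a
    exact h1.comp_smul (by norm_num)
  · have h := MeasureTheory.Measure.integral_comp_smul
      (MeasureTheory.volume : MeasureTheory.Measure V) (fun y => F (y - a)) 2
    rw [h, MeasureTheory.integral_sub_right_eq_self]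
    simp
    left
    norm_num

theorem D_dbl {g : V → E4} (hg : Sm g) : D (dbl g) = 2 * D g := by
  rw [(dbl_sm hg).D_full, hg.D_full]
  simp only [dn_dbl hg]
  obtain ⟨i0, h0⟩ := int_scale hg.dn_int 0
  obtain ⟨i1, h1⟩ := int_scale hg.dn_int e0
  rw [MeasureTheory.integral_add (i0.const_mul 8) (i1.const_mul 8),
    MeasureTheory.integral_const_mul, MeasureTheory.integral_const_mul, h0, h1]
  ring

/-! the starting map -/

noncomputable def c0 : V := fun _ => 1/2

noncomputable def bmp : ContDiffBump c0 := ⟨1/4, 1/2, by norm_num, by norm_num⟩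

noncomputable def phi (x : V) : E4 := (1 - 2 * bmp x, bmp x • (x - c0))

noncomputable def psi (x : V) : E4 := (-1, x - c0)

theorem psi_ne (x : V) : psi x ≠ 0 := by
  intro h
  have := congrArg Prod.fst h
  simp [psi] at this

theorem psi_smooth : ContDiff ℝ ((⊤ : ℕ∞) : WithTop ℕ∞) psi := by
  unfold psi
  fun_prop

theorem phi_sm : Sm phi := by
  refine ⟨?_, ?_, ?_⟩
  · have hb : ContDiff ℝ ((⊤ : ℕ∞) : WithTop ℕ∞) (fun x : V => bmp x) := bmp.contDiff
    unfold phi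
    exact (contDiff_const.sub (contDiff_const.mul hb)).prodMk
      (hb.smul (contDiff_id.sub contDiff_const))
  · intro x h
    have h1 := congrArg Prod.fst h
    have h2 := congrArg Prod.snd h
    simp only [phi, Prod.fst_zero, Prod.snd_zero] at h1 h2
    have hs : bmp x = 1/2 := by linarith
    rw [hs] at h2
    have hx : x = c0 := by
      rcases smul_eq_zero.1 h2 with h3 | h3
      · norm_num at h3
      · exact sub_eq_zero.1 h3
    have h4 : bmp x = 1 := bmp.one_of_mem_closedBall (by
      rw [hx]
      exact Metric.mem_closedBall_self bmp.rIn_pos.le)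
    rw [h4] at hs
    norm_num at hs
  · intro x i hi
    have hd : (1/2 : ℝ) ≤ dist x c0 := by
      refine le_trans ?_ (dist_le_pi_dist x c0 i)
      rw [Real.dist_eq, c0]
      rcases hi with hi | hi
      · rw [abs_of_nonpos (by linarith)]
        linarith
      · rw [abs_of_nonneg (by linarith)]
        linarith
    have : bmp x = 0 := bmp.zero_of_le_dist hd
    simp [phi, this, b0]

theorem phi_near {x : V} (hx : dist x c0 < 1/4) : phi =ᶠ[𝓝 x] psi := by
  have : ∀ᶠ y : V in 𝓝 x, dist y c0 < 1/4 :=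
    (isOpen_lt (by fun_prop) continuous_const).mem_nhds hx
  filter_upwards [this] with y hy
  have h4 : bmp y = 1 := bmp.one_of_mem_closedBall (le_of_lt hy)
  simp only [phi, psi, h4, one_smul]
  norm_num

theorem dn_far {x : V} (hx : 1/4 ≤ dist x c0) : dn phi x = 0 := by
  unfold dn dens
  rw [chi_zero, zero_mul]
  show -(98/100) ≤ nz (phi x) 0
  rw [nz_zero]
  have hN := nN_pos (phi_sm.ne x)
  have hr : (1/16 : ℝ) ≤ ∑ i, (x i - 1/2) ^ 2 := by
    by_contra h
    push Not at h
    have : dist x c0 < 1/4 := by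
      rw [dist_pi_lt_iff (by norm_num)]
      intro i
      have h1 : (x i - 1/2) ^ 2 ≤ ∑ i, (x i - 1/2) ^ 2 :=
        Finset.single_le_sum (f := fun i => (x i - 1/2) ^ 2) (fun i _ => sq_nonneg _)
          (Finset.mem_univ i)
      rw [Real.dist_eq]
      apply abs_lt_of_sq_lt_sq _ (by norm_num)
      simp only [c0]
      linarith
    linarith
  have hs0 : 0 ≤ bmp x := bmp.nonneg
  have hs1 : bmp x ≤ 1 := bmp.le_one
  have hNe : nN (phi x) = (1 - 2 * bmp x) ^ 2 + (bmp x) ^ 2 * ∑ i, (x i - 1/2) ^ 2 := by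
    simp only [nN, phi, Pi.smul_apply, Pi.sub_apply, smul_eq_mul, c0, mul_pow, Finset.mul_sum]
  have hfst : (phi x).1 = 1 - 2 * bmp x := rfl
  rw [hfst, le_div_iff₀ (Real.sqrt_pos.2 hN)]
  rcases le_total 0 (1 - 2 * bmp x) with h | h
  · have := Real.sqrt_nonneg (nN (phi x))
    linarith
  · have h1 : (2 * bmp x - 1) * (100 / 98) ≤ √(nN (phi x)) := by
      apply Real.le_sqrt_of_sq_le
      rw [hNe]
      have h2 : (bmp x) ^ 2 * (1/16) ≤ (bmp x) ^ 2 * ∑ i, (x i - 1/2) ^ 2 :=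
        mul_le_mul_of_nonneg_left hr (sq_nonneg _)
      have h3 : (2 * bmp x - 1) ^ 2 ≤ (bmp x) ^ 2 := by nlinarith
      nlinarith
    linarith

theorem psi_deriv (x : V) (j a : Fin 3) :
    fderiv ℝ (fun x => nz (psi x)) x (Pi.single j 1) a.succ
      = (if a = j then 1 else 0) / √(nN (psi x))
        - (x a - 1/2) * (x j - 1/2) / (√(nN (psi x))) ^ 3 := by
  have hs := contDiff_nz psi_smooth psi_ne
  have h : HasFDerivAt (fun x => nz (psi x)) (fderiv ℝ (fun x => nz (psi x)) x)
      (x + (0 : ℝ) • (Pi.single j 1 : V)) := by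
    simpa using ((hs.differentiable (by simp)) x).hasFDerivAt
  have hl : HasDerivAt (fun t : ℝ => x + t • (Pi.single j 1 : V)) (Pi.single j 1) 0 := by
    simpa using ((hasDerivAt_id (0 : ℝ)).smul_const (Pi.single j 1 : V)).const_add x
  have h1 := hasDerivAt_pi.1 (h.comp_hasDerivAt 0 hl) a.succ
  have hN := nN_pos (psi_ne x)
  have hlin : ∀ b : Fin 3, HasDerivAt
      (fun t : ℝ => (psi (x + t • (Pi.single j 1 : V))).2 b) (if b = j then 1 else 0) 0 := by
    intro b
    have h2 := (hasDerivAt_pi.1 hl b).sub_const (c0 b)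
    refine HasDerivAt.congr_deriv h2 ?_
    simp [Pi.single_apply]
  have hNd : HasDerivAt (fun t : ℝ => nN (psi (x + t • (Pi.single j 1 : V))))
      (2 * (x j - 1/2)) 0 := by
    have h2 : HasDerivAt (fun t : ℝ => ∑ b, (psi (x + t • (Pi.single j 1 : V))).2 b ^ 2)
        (∑ b, 2 * (x b - 1/2) * (if b = j then 1 else 0)) 0 := by
      apply HasDerivAt.fun_sum
      intro b _
      refine HasDerivAt.congr_deriv ((hlin b).pow 2) ?_
      simp [psi, c0]
    have h3 := h2.const_add (((-1 : ℝ)) ^ 2)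
    refine HasDerivAt.congr_deriv h3 ?_
    simp
  have hx0 : x + (0 : ℝ) • (Pi.single j 1 : V) = x := by simp
  have hsq := hNd.sqrt (by rw [hx0]; exact hN.ne')
  have hsp := Real.sqrt_pos.2 hN
  have h5 := (hlin a).fun_div hsq (by rw [hx0]; exact hsp.ne')
  have h6 := h1.unique h5
  rw [h6, hx0]
  have : (psi x).2 a = x a - 1/2 := rfl
  rw [this]
  field_simp

theorem dn_psi (x : V) : 0 ≤ det3 (fderiv ℝ (fun x => nz (psi x)) x (Pi.single 0 1))
    (fderiv ℝ (fun x => nz (psi x)) x (Pi.single 1 1))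
    (fderiv ℝ (fun x => nz (psi x)) x (Pi.single 2 1)) ∧
    0 < det3 (fderiv ℝ (fun x => nz (psi x)) x (Pi.single 0 1))
    (fderiv ℝ (fun x => nz (psi x)) x (Pi.single 1 1))
    (fderiv ℝ (fun x => nz (psi x)) x (Pi.single 2 1)) := by
  rw [and_iff_right_of_imp le_of_lt]
  have hN := nN_pos (psi_ne x)
  have hsp := Real.sqrt_pos.2 hN
  have hsq := Real.sq_sqrt hN.le
  have h := psi_deriv x
  have e1 : (1 : Fin 4) = (0 : Fin 3).succ := rfl
  have e2 : (2 : Fin 4) = (1 : Fin 3).succ := rfl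
  have e3 : (3 : Fin 4) = (2 : Fin 3).succ := rfl
  unfold det3
  rw [e1, e2, e3]
  simp only [h]
  have hNe : nN (psi x) = 1 + ((x 0 - 1/2) ^ 2 + (x 1 - 1/2) ^ 2 + (x 2 - 1/2) ^ 2) := by
    simp [nN, psi, c0, Fin.sum_univ_three]
  generalize √(nN (psi x)) = r at *
  rw [hNe] at hsq
  generalize x 0 - 1/2 = a at *
  generalize x 1 - 1/2 = b at *
  generalize x 2 - 1/2 = c at *
  have hpos : 0 < 1 / r ^ 5 := by positivity
  refine lt_of_lt_of_eq hpos ?_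
  have hk : (1 : ℝ) / r ^ 5 = 1 / r ^ 3 - (a ^ 2 + b ^ 2 + c ^ 2) / r ^ 5 := by
    have : a ^ 2 + b ^ 2 + c ^ 2 = r ^ 2 - 1 := by linarith
    rw [this]
    field_simp
    ring
  rw [hk]
  simp
  field_simp
  ring

theorem D_phi_pos : 0 < D phi := by
  rw [phi_sm.D_full]
  have key : ∀ x, 0 ≤ dn phi x := by
    intro x
    rcases lt_or_ge (dist x c0) (1/4) with h | h
    · have e : dn phi x = dn psi x := by
        apply dens_congr
        filter_upwards [phi_near h] with y hy
        rw [hy]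
      rw [e]
      exact mul_nonneg (chi_nonneg _) (dn_psi x).1
    · exact (dn_far h).ge
  refine phi_sm.dn_cont.integral_pos_of_hasCompactSupport_nonneg_nonzero phi_sm.dn_cs key
    (x := c0) ?_
  have e : dn phi c0 = dn psi c0 := by
    apply dens_congr
    filter_upwards [phi_near (x := c0) (by simp)] with y hy
    rw [hy]
  rw [e]
  refine (mul_pos (chi_pos ?_) (dn_psi c0).2).ne'
  simp [nz_zero, nN, psi]
  norm_num

noncomputable def seq : ℕ → {g : V → E4 // Sm g}
  | 0 => ⟨phi, phi_sm⟩
  | n + 1 => ⟨dbl (seq n).1, dbl_sm (seq n).2⟩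

theorem D_seq (n : ℕ) : D (seq n).1 = 2 ^ n * D phi := by
  induction n with
  | zero => simp [seq]
  | succ n ih =>
    show D (dbl (seq n).1) = _
    rw [D_dbl (seq n).2, ih]
    ring

theorem infinite_P3 : Infinite P3 := by
  refine Infinite.of_injective (fun n : ℕ => (cl (lp (seq n).2) : P3)) ?_
  intro n m h
  have h1 := D_eq _ _ h
  rw [D_seq, D_seq] at h1
  have h2 : (2 : ℝ) ^ n = 2 ^ m := mul_right_cancel₀ D_phi_pos.ne' h1
  exact pow_right_injective₀ (by norm_num) (by norm_num) h2

end Pi3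

open scoped unitInterval Topology Topology.Homotopy
namespace Pi3

theorem exists_equivY (y : Yc) : Nonempty (HomotopyGroup (Fin 3) Yc y ≃* P3) := by
  have hfr : Module.finrank ℝ (ℂ × ℂ) = Module.finrank ℝ E4 := by
    simp [Complex.finrank_real_complex]
  let L : (ℂ × ℂ) ≃L[ℝ] E4 := ContinuousLinearEquiv.ofFinrankEq hfr
  have hLy : L y.1 ≠ 0 := by
    intro h
    exact y.2 (L.map_eq_zero_iff.1 h)
  obtain ⟨A, hA⟩ := SeparatingDual.exists_continuousLinearEquiv_apply_eq (R := ℝ) hLy b0_ne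
  let B := L.trans A
  have hB : ∀ z : ℂ × ℂ, z ≠ 0 ↔ B z ≠ 0 := fun z => by
    rw [Ne, Ne, B.map_eq_zero_iff]
  let e : Yc ≃ₜ Y4 := B.toHomeomorph.subtype hB
  exact ⟨piEquiv e (Subtype.ext hA)⟩

end Pi3

/-- The third homotopy group of the 2-sphere is infinite cyclic: `π₃(S², N) ≅ ℤ`. -/
theorem pi3_sphere2_iso_int (N : Metric.sphere (0 : EuclideanSpace ℝ (Fin 3)) 1) :
    Nonempty
      (HomotopyGroup (Fin 3) (Metric.sphere (0 : EuclideanSpace ℝ (Fin 3)) 1) N ≃*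
        Multiplicative ℤ) := by
  obtain ⟨y, rfl⟩ := Pi3.hopf_surj N
  obtain ⟨e⟩ := Pi3.exists_equivY y
  have := Pi3.infinite_P3
  have h : Subgroup.zpowers Pi3.gen = ⊤ := by
    rw [eq_top_iff]
    intro c _
    exact Pi3.mem_HZ c
  exact ⟨((Pi3.hopfEquiv y).symm.trans e).trans (intEquivOfZPowersEqTop Pi3.gen h).symm⟩
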